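/- arXiv:2110.04302 — 5 statements merged into one kernel-verified Lean document; each statement's English description precedes it below -/
import Mathlib

section
/- For every real constant c with 1/2 ≤ c ≤ 1, the quantity n · ∏_{p prime, p_n < p ≤ (p_n#)^c} (p−1)/p tends to 1/c as n → ∞. (This is the case k = 1 of the asymptotic L_1(p_n; n) ~ θ_1 n^{−1} with θ_1 = 1/c.) -/
open Filter Finset

/-- `nthPrime n` is the `n`-th prime `pₙ`, with `p₁ = 2`. -/
noncomputable def nthPrime (n : ℕ) : ℕ := Nat.nth Nat.Prime (n - 1)

/-- `primorial n = pₙ# = ∏_{i=1}^{n} pᵢ`, the product of the first `n` primes. -/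
noncomputable def primorial' (n : ℕ) : ℕ := ∏ i ∈ Finset.range n, Nat.nth Nat.Prime i

open Real in
lemma sum_Ioc_vonMangoldt_mul_floor (N : ℕ) :
    ∑ n ∈ Ioc 0 N, ArithmeticFunction.vonMangoldt n * (N / n : ℕ) = log N.factorial := by
  rw [← ArithmeticFunction.sum_Ioc_mul_zeta_eq_sum]
  rw [ArithmeticFunction.vonMangoldt_mul_zeta]
  induction N with
  | zero => simp
  | succ k ih =>
    rw [Finset.sum_Ioc_succ_top (Nat.zero_le k), ih, Nat.factorial_succ]
    push_cast
    rw [log_mul (by positivity) (by positivity), ArithmeticFunction.log_apply]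
    push_cast
    ring

open Real in
/-- Mertens' first theorem in terms of the von Mangoldt function. -/
lemma abs_sum_vonMangoldt_div_sub_log_le {N : ℕ} (hN : 0 < N) :
    |∑ n ∈ Ioc 0 N, ArithmeticFunction.vonMangoldt n / n - log N| ≤ log 4 + 4 := by
  have hN' : (0 : ℝ) < N := by exact_mod_cast hN
  have hfac := sum_Ioc_vonMangoldt_mul_floor N
  have hpsi : ∑ n ∈ Ioc 0 N, ArithmeticFunction.vonMangoldt n ≤ (log 4 + 4) * N := by
    have := Chebyshev.psi_le_const_mul_self hN'.le
    simpa [Chebyshev.psi] using this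
  have hlow : N * log N - N ≤ log N.factorial := by
    have h1 := Stirling.le_log_factorial_stirling hN.ne'
    have h2 : 0 ≤ log N := log_natCast_nonneg N
    have h3 : 0 ≤ log (2 * π) := log_nonneg (by linarith [pi_gt_three])
    linarith
  have hup : log N.factorial ≤ N * log N := by
    rw [← log_pow]
    exact log_le_log (by positivity) (by exact_mod_cast Nat.factorial_le_pow N)
  have h1 : log N.factorial ≤ N * ∑ n ∈ Ioc 0 N, ArithmeticFunction.vonMangoldt n / n := by
    rw [← hfac, mul_sum]
    refine sum_le_sum fun n hn => ?_
    have : ((N / n : ℕ) : ℝ) ≤ N / n := Nat.cast_div_le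
    calc _ ≤ ArithmeticFunction.vonMangoldt n * ((N : ℝ) / n) := by
          gcongr
      _ = _ := by ring
  have h2 : N * ∑ n ∈ Ioc 0 N, ArithmeticFunction.vonMangoldt n / n ≤
      log N.factorial + (log 4 + 4) * N := by
    refine le_trans ?_ (add_le_add_right hpsi _)
    rw [← hfac, mul_sum, ← sum_add_distrib]
    refine sum_le_sum fun n hn => ?_
    have hn0 : 0 < n := (mem_Ioc.1 hn).1
    have : (N : ℝ) / n ≤ (N / n : ℕ) + 1 := by
      rw [div_le_iff₀ (by exact_mod_cast hn0)]
      exact_mod_cast (Nat.lt_div_mul_add hn0 (a := N)).le.trans (by rw [add_mul, one_mul])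
    calc _ = ArithmeticFunction.vonMangoldt n * ((N : ℝ) / n) := by ring
      _ ≤ ArithmeticFunction.vonMangoldt n * ((N / n : ℕ) + 1) := by
          gcongr
      _ = _ := by ring
  have hlog4 : 0 ≤ log 4 := log_nonneg (by norm_num)
  rw [abs_le]
  constructor
  · refine le_of_mul_le_mul_left ?_ hN'
    nlinarith
  · refine le_of_mul_le_mul_left ?_ hN'
    nlinarith

open Real in
/-- If the summatory function of `d` is `O(√N)`, then `∑ d n / n` has bounded partial sums. -/
lemma sum_div_le_of_sum_le_sqrt {d : ℕ → ℝ} {C : ℝ} (hC : 0 ≤ C)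
    (hd : ∀ N : ℕ, ∑ n ∈ Ioc 0 N, d n ≤ C * √N) {N : ℕ} (hN : 0 < N) :
    ∑ n ∈ Ioc 0 N, d n / n ≤ 3 * C := by
  have key : ∑ n ∈ Ioc 0 N, d n / n ≤ (∑ n ∈ Ioc 0 N, d n) / N + 2 * C * (1 - 1 / √N) := by
    induction N, hN using Nat.le_induction with
    | base => simp
    | succ k hk ih =>
      rw [Finset.sum_Ioc_succ_top (Nat.zero_le k), Finset.sum_Ioc_succ_top (Nat.zero_le k)]
      have hk0 : (0 : ℝ) < k := by exact_mod_cast hk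
      push_cast
      have hD := hd k
      set D := ∑ n ∈ Ioc 0 k, d n
      set s := √(k : ℝ) with hs
      set t := √((k : ℝ) + 1) with ht
      have hs0 : 0 < s := sqrt_pos.2 hk0
      have ht0 : 0 < t := sqrt_pos.2 (by linarith)
      have hst : s ≤ t := sqrt_le_sqrt (by linarith)
      have hs2 : s ^ 2 = k := sq_sqrt hk0.le
      have ht2 : t ^ 2 = (k : ℝ) + 1 := sq_sqrt (by linarith)
      have h1 : D / k - D / (k + 1) ≤ 2 * C * (1 / s - 1 / t) := by
        have e1 : D / k - D / (k + 1) = D / (s ^ 2 * t ^ 2) := by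
          rw [hs2, ht2]; field_simp; ring
        have e2 : 1 / s - 1 / t = 1 / (s * t * (s + t)) := by
          have : (t - s) * (t + s) = 1 := by nlinarith
          field_simp
          linarith
        rw [e1, e2]
        calc D / (s ^ 2 * t ^ 2) ≤ C * s / (s ^ 2 * t ^ 2) := by gcongr
          _ = 2 * C * (1 / (s * t * (t + t))) := by field_simp; ring
          _ ≤ 2 * C * (1 / (s * t * (s + t))) := by gcongr
      have h2 : (D + d (k + 1)) / (k + 1) = D / (k + 1) + d (k + 1) / (k + 1) := by ring
      rw [h2]
      linarith
  have hN' : (1 : ℝ) ≤ N := by exact_mod_cast hN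
  have h1 : (∑ n ∈ Ioc 0 N, d n) / N ≤ C := by
    rw [div_le_iff₀ (by linarith)]
    refine (hd N).trans ?_
    gcongr
    exact sqrt_le_iff.2 ⟨by linarith, by nlinarith⟩
  have h2 : 0 ≤ C * (1 / √N) := by positivity
  linarith

open Real in
/-- Mertens' first theorem. -/
lemma exists_abs_sum_log_prime_div_sub_log_le :
    ∃ C : ℝ, ∀ N : ℕ, 0 < N →
      |∑ n ∈ Ioc 0 N, (if n.Prime then log n / n else 0) - log N| ≤ C := by
  obtain ⟨C, hC⟩ := Chebyshev.psi_sub_theta_le_mul_sqrt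
  set d : ℕ → ℝ := fun n => if n.Prime then 0 else ArithmeticFunction.vonMangoldt n
  have hd0 : ∀ n, 0 ≤ d n := fun n => by
    simp only [d]; split_ifs
    exacts [le_rfl, ArithmeticFunction.vonMangoldt_nonneg]
  have hd : ∀ N : ℕ, ∑ n ∈ Ioc 0 N, d n ≤ |C| * √N := fun N => by
    have h := hC N
    rw [Chebyshev.psi_sub_theta_eq_sum_not_prime, Nat.floor_natCast, sum_filter] at h
    refine le_trans (le_of_eq ?_) (h.trans (by gcongr; exact le_abs_self C))
    refine sum_congr rfl fun n _ => ?_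
    by_cases hn : n.Prime <;> simp [d, hn]
  refine ⟨log 4 + 4 + 3 * |C|, fun N hN => ?_⟩
  have h1 := abs_le.1 (abs_sum_vonMangoldt_div_sub_log_le hN)
  have h2 := sum_div_le_of_sum_le_sqrt (abs_nonneg C) hd hN
  have h3 : 0 ≤ ∑ n ∈ Ioc 0 N, d n / n :=
    sum_nonneg fun n _ => div_nonneg (hd0 n) (Nat.cast_nonneg n)
  have h4 : ∑ n ∈ Ioc 0 N, ArithmeticFunction.vonMangoldt n / n =
      ∑ n ∈ Ioc 0 N, (if n.Prime then log n / n else 0) + ∑ n ∈ Ioc 0 N, d n / n := by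
    rw [← sum_add_distrib]
    refine sum_congr rfl fun n _ => ?_
    by_cases hn : n.Prime
    · simp [d, hn, ArithmeticFunction.vonMangoldt_apply_prime hn]
    · simp [d, hn]
  rw [abs_le]
  constructor <;> linarith [abs_nonneg C]

lemma exists_tendsto_of_abs_sub_le_sub {F u : ℕ → ℝ} (hu : ∀ n, 0 ≤ u n)
    (h : ∀ n, |F (n + 1) - F n| ≤ u n - u (n + 1)) : ∃ l, Tendsto F atTop (nhds l) := by
  have h' := fun n => abs_le.1 (h n)
  have hua : Antitone u := antitone_nat_of_succ_le fun n => by linarith [(h' n).1, (h' n).2]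
  have hm : Monotone (fun n => F n - u n) := monotone_nat_of_le_succ fun n => by
    linarith [(h' n).1]
  have ha : Antitone (fun n => F n + u n) := antitone_nat_of_succ_le fun n => by
    linarith [(h' n).2]
  have h1 := tendsto_atTop_ciInf hua ⟨0, by rintro _ ⟨n, rfl⟩; exact hu n⟩
  have h2 := tendsto_atTop_ciSup hm ⟨F 0 + u 0, by
    rintro _ ⟨n, rfl⟩
    have := ha (Nat.zero_le n)
    have := hu n
    dsimp only at *
    linarith⟩
  exact ⟨_, (h2.add h1).congr fun n => by ring⟩

open Real in
/-- Mertens' second theorem. -/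
lemma exists_tendsto_sum_prime_inv_sub_log_log :
    ∃ l, Tendsto (fun N : ℕ => ∑ n ∈ Ioc 0 N, (if n.Prime then (1 : ℝ) / n else 0) - log (log N))
      atTop (nhds l) := by
  obtain ⟨C, hC⟩ := exists_abs_sum_log_prime_div_sub_log_le
  have hC0 : 0 ≤ C := (abs_nonneg _).trans (hC 1 one_pos)
  set E : ℕ → ℝ := fun N => ∑ n ∈ Ioc 0 N, (if n.Prime then log n / n else 0) - log N with hE
  set T : ℕ → ℝ := fun N => ∑ n ∈ Ioc 0 N, (if n.Prime then (1 : ℝ) / n else 0) - log (log N)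
    with hT
  have hlog : Tendsto (fun N : ℕ => log (N : ℝ)) atTop atTop :=
    tendsto_log_atTop.comp tendsto_natCast_atTop_atTop
  have hEL : Tendsto (fun N : ℕ => E N / log N) atTop (nhds 0) := by
    refine squeeze_zero_norm' ?_ (hlog.const_div_atTop C)
    filter_upwards [eventually_gt_atTop 0] with N hN
    rw [norm_div, norm_eq_abs, norm_of_nonneg (log_natCast_nonneg N)]
    exact div_le_div_of_nonneg_right (hC N hN) (log_natCast_nonneg N)
  obtain ⟨l, hl⟩ := exists_tendsto_of_abs_sub_le_sub
    (F := fun n => T (n + 2) - E (n + 2) / log (n + 2 : ℕ))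
    (u := fun n => (C + 1) * (1 / log (n + 2 : ℕ)))
    (fun n => mul_nonneg (by linarith) (one_div_nonneg.2 (log_natCast_nonneg _))) (by
      intro n
      have hM : 2 ≤ n + 2 := by omega
      have e : n + 1 + 2 = n + 2 + 1 := by ring
      simp only [e]
      generalize n + 2 = M at hM
      have hM' : (2 : ℝ) ≤ M := by exact_mod_cast hM
      have hEM := abs_le.1 (hC M (by omega))
      have hL : 0 < log M := log_pos (by linarith)
      have hLL : log M < log (M + 1 : ℕ) := log_lt_log (by linarith) (by push_cast; linarith)
      have hL' : 0 < log (M + 1 : ℕ) := hL.trans hLL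
      have hb : log (M + 1 : ℕ) - log M ≤ 1 := by
        rw [← log_div (by positivity) (by positivity)]
        refine (log_le_sub_one_of_pos (by positivity)).trans ?_
        push_cast
        rw [sub_le_iff_le_add, div_le_iff₀ (by linarith)]
        linarith
      have hΔ₁ : log (log (M + 1 : ℕ)) - log (log M) ≤ log (M + 1 : ℕ) / log M - 1 := by
        rw [← log_div hL'.ne' hL.ne']
        exact log_le_sub_one_of_pos (by positivity)
      have hΔ₂ : 1 - log M / log (M + 1 : ℕ) ≤ log (log (M + 1 : ℕ)) - log (log M) := by
        rw [← log_div hL'.ne' hL.ne']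
        have := one_sub_inv_le_log_of_pos (x := log (M + 1 : ℕ) / log M) (by positivity)
        rwa [inv_div] at this
      have hTd : T (M + 1) - T M = (log (M + 1 : ℕ) - log M + E (M + 1) - E M) / log (M + 1 : ℕ)
          - (log (log (M + 1 : ℕ)) - log (log M)) := by
        simp only [hT, hE]
        rw [Finset.sum_Ioc_succ_top (Nat.zero_le M), Finset.sum_Ioc_succ_top (Nat.zero_le M)]
        by_cases hp : (M + 1).Prime
        · simp only [hp, if_true]
          field_simp
          ring
        · simp only [hp, if_false]
          ring
      change -C ≤ E M ∧ E M ≤ C at hEM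
      set L := log M
      set L' := log (M + 1 : ℕ)
      set D := log L' - log L
      have hF : T (M + 1) - E (M + 1) / L' - (T M - E M / L) =
          (L' - L) / L' - D + E M * (1 / L - 1 / L') := by
        have : T (M + 1) - E (M + 1) / L' - (T M - E M / L) =
          (T (M + 1) - T M) - E (M + 1) / L' + E M / L := by ring
        rw [this, hTd]
        ring
      have hw : 0 ≤ 1 / L - 1 / L' := by
        rw [sub_nonneg]; gcongr
      rw [hF]
      have e1 : (L' - L) / L' = 1 - L / L' := by field_simp
      have e2 : L' / L - 1 = (L' - L) / L' + (L' - L) * (1 / L - 1 / L') := by field_simp; ring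
      have e3 : (L' - L) * (1 / L - 1 / L') ≤ 1 * (1 / L - 1 / L') := by gcongr
      have e4 : E M * (1 / L - 1 / L') ≤ C * (1 / L - 1 / L') := by gcongr; exact hEM.2
      have e5 : -C * (1 / L - 1 / L') ≤ E M * (1 / L - 1 / L') := by gcongr; exact hEM.1
      rw [abs_le]
      constructor <;> linarith)
  rw [tendsto_add_atTop_iff_nat (f := fun n => T n - E n / log (n : ℕ)) 2] at hl
  exact ⟨l + 0, (hl.add hEL).congr fun n => by ring⟩

open Real in
lemma summable_log_one_sub_inv_add_inv :
    Summable (fun n : ℕ => if n.Prime then log (1 - 1 / n) + 1 / n else 0) := by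
  rw [← summable_neg_iff]
  refine Summable.of_nonneg_of_le (f := fun n : ℕ => 2 * (1 / (n : ℝ) ^ 2)) (fun n => ?_)
    (fun n => ?_) ((summable_one_div_nat_pow.2 one_lt_two).mul_left 2)
  · split_ifs with hp
    · have hn : (2 : ℝ) ≤ n := by exact_mod_cast hp.two_le
      have h1 : (1 : ℝ) / n < 1 := by rw [div_lt_one (by linarith)]; linarith
      have := log_le_sub_one_of_pos (x := 1 - 1 / (n : ℝ)) (by linarith)
      linarith
    · simp
  · split_ifs with hp
    · have hn : (2 : ℝ) ≤ n := by exact_mod_cast hp.two_le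
      have h1 : (1 : ℝ) / n < 1 := by rw [div_lt_one (by linarith)]; linarith
      have h2 := one_sub_inv_le_log_of_pos (x := 1 - 1 / (n : ℝ)) (by linarith)
      have h3 : (1 - 1 / (n : ℝ))⁻¹ - 1 - 1 / n ≤ 2 * (1 / (n : ℝ) ^ 2) := by
        have hn1 : (0 : ℝ) < n - 1 := by linarith
        have e : (1 - 1 / (n : ℝ))⁻¹ - 1 - 1 / n = 1 / (n * (n - 1)) := by
          have : (1 - 1 / (n : ℝ)) = (n - 1) / n := by field_simp
          rw [this, inv_div]
          field_simp
          ring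
        rw [e, mul_one_div, div_le_div_iff₀ (by positivity) (by positivity)]
        nlinarith
      linarith
    · simp only [neg_zero]; positivity

open Real in
/-- Mertens' third theorem in logarithmic form, with an unspecified constant. -/
lemma exists_tendsto_sum_log_one_sub_inv_add_log_log :
    ∃ l, Tendsto (fun N : ℕ => ∑ n ∈ Ioc 0 N, (if n.Prime then log (1 - 1 / (n : ℝ)) else 0)
      + log (log N)) atTop (nhds l) := by
  obtain ⟨l, hl⟩ := exists_tendsto_sum_prime_inv_sub_log_log
  have h := (tendsto_add_atTop_iff_nat 1).2 summable_log_one_sub_inv_add_inv.hasSum.tendsto_sum_nat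
  refine ⟨_, (h.sub hl).congr fun N => ?_⟩
  have : ∑ n ∈ range (N + 1), (if n.Prime then log (1 - 1 / (n : ℝ)) + 1 / n else 0) =
      ∑ n ∈ Ioc 0 N, (if n.Prime then log (1 - 1 / (n : ℝ)) + 1 / n else 0) := by
    rw [Nat.range_succ_eq_Icc_zero, Icc_eq_cons_Ioc (Nat.zero_le N), sum_cons]
    simp
  rw [this, ← sub_add, ← sum_sub_distrib]
  congr 1
  refine sum_congr rfl fun n _ => ?_
  split_ifs <;> ring

open Real in
lemma eventually_half_le_theta : ∀ᶠ n : ℕ in atTop, (n : ℝ) / 2 ≤ Chebyshev.theta n := by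
  have h := (isLittleO_log_rpow_atTop (r := 1 / 2) (by norm_num)).bound
    (c := 1 / 25) (by norm_num)
  filter_upwards [tendsto_natCast_atTop_atTop.eventually h, eventually_ge_atTop 2] with n hn h2
  have h2' : (2 : ℝ) ≤ n := by exact_mod_cast h2
  have hl : 0 ≤ log n := log_natCast_nonneg n
  rw [← sqrt_eq_rpow, norm_of_nonneg hl, norm_of_nonneg (sqrt_nonneg _)] at hn
  have hs : √(n : ℝ) * √n = n := mul_self_sqrt (by linarith)
  have hs1 : 1 ≤ √(n : ℝ) := one_le_sqrt.2 (by linarith)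
  have hlog : log ((n : ℝ) + 1) ≤ 2 * log n := by
    rw [← Nat.cast_ofNat, ← log_pow]
    exact log_le_log (by positivity) (by nlinarith)
  have := Chebyshev.theta_ge n
  have h5 : √(n : ℝ) * log n ≤ √n * (1 / 25 * √n) := by gcongr
  have h6 : log n ≤ √(n : ℝ) * log n := le_mul_of_one_le_left hl hs1
  nlinarith [log_two_gt_d9]

open Real in
lemma tendsto_primeCounting_mul_log_div_theta :
    Tendsto (fun n : ℕ => (Nat.primeCounting n : ℝ) * log n / Chebyshev.theta n) atTop
      (nhds 1) := by
  have hlog : Tendsto (fun N : ℕ => log (N : ℝ)) atTop atTop :=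
    tendsto_log_atTop.comp tendsto_natCast_atTop_atTop
  obtain ⟨C, hC⟩ := Chebyshev.primeCounting_sub_theta_div_log_isBigO.bound
  rw [tendsto_iff_norm_sub_tendsto_zero]
  refine squeeze_zero_norm' ?_ (hlog.const_div_atTop (2 * C))
  filter_upwards [tendsto_natCast_atTop_atTop.eventually hC, eventually_half_le_theta,
    eventually_ge_atTop 2] with n hn hθ h2
  have h2' : (2 : ℝ) ≤ n := by exact_mod_cast h2
  have hl : 0 < log n := log_pos (by linarith)
  have hθ0 : 0 < Chebyshev.theta n := lt_of_lt_of_le (by linarith) hθ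
  rw [Nat.floor_natCast] at hn
  have e : (Nat.primeCounting n : ℝ) * log n / Chebyshev.theta n - 1 =
      (Nat.primeCounting n - Chebyshev.theta n / log n) * (log n / Chebyshev.theta n) := by
    field_simp
  rw [e, norm_norm, norm_mul, norm_of_nonneg (div_nonneg hl.le hθ0.le)]
  rw [norm_of_nonneg (r := (n : ℝ) / log n ^ 2) (by positivity)] at hn
  have hC0 : 0 ≤ C * (n / log n ^ 2) := (norm_nonneg _).trans hn
  calc _ ≤ C * (n / log n ^ 2) * (log n / (n / 2)) := by gcongr
    _ = 2 * C / log n := by field_simp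

lemma nthPrime_add_one (n : ℕ) : nthPrime (n + 1) = Nat.nth Nat.Prime n := rfl

lemma primeCounting_nth_prime (n : ℕ) : Nat.primeCounting (Nat.nth Nat.Prime n) = n + 1 := by
  rw [Nat.primeCounting_eq_primeCounting'_succ, Nat.primeCounting']
  exact Nat.count_nth_succ_of_infinite Nat.infinite_setOfPred_prime n

open Real in
lemma log_primorial' (n : ℕ) :
    log (primorial' (n + 1)) = Chebyshev.theta (Nat.nth Nat.Prime n) := by
  rw [Chebyshev.theta_eq_sum_primesLE_log, primorial', Nat.cast_prod,
    log_prod fun i _ => by exact_mod_cast (Nat.prime_nth_prime i).ne_zero]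
  refine sum_bij (fun i _ => Nat.nth Nat.Prime i) (fun i hi => ?_) (fun i _ j _ h => ?_)
    (fun p hp => ?_) (fun _ _ => rfl)
  · rw [Nat.mem_primesLE]
    exact ⟨(Nat.nth_le_nth Nat.infinite_setOfPred_prime).2 (by simpa [Nat.lt_succ_iff] using hi),
      Nat.prime_nth_prime i⟩
  · exact Nat.nth_injective Nat.infinite_setOfPred_prime h
  · rw [Nat.mem_primesLE] at hp
    refine ⟨Nat.count Nat.Prime p, ?_, Nat.nth_count hp.2⟩
    rw [mem_range, Nat.lt_succ_iff, ← Nat.nth_le_nth Nat.infinite_setOfPred_prime, Nat.nth_count hp.2]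
    exact hp.1

open Real in
lemma prod_prime_one_sub_inv_eq {M N : ℕ} (hM : 2 ≤ M) (hMN : M ≤ N) :
    ∏ p ∈ (Ioc M N).filter Nat.Prime, ((p : ℝ) - 1) / p =
      exp ((∑ n ∈ Ioc 0 N, (if n.Prime then log (1 - 1 / (n : ℝ)) else 0) + log (log N)) -
        (∑ n ∈ Ioc 0 M, (if n.Prime then log (1 - 1 / (n : ℝ)) else 0) + log (log M))) *
      (log M / log N) := by
  have hM' : (2 : ℝ) ≤ M := by exact_mod_cast hM
  have hN' : (2 : ℝ) ≤ N := by exact_mod_cast hM.trans hMN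
  have hlM : 0 < log (M : ℝ) := log_pos (by linarith)
  have hlN : 0 < log (N : ℝ) := log_pos (by linarith)
  have hsum := sum_Ioc_consecutive
    (fun n : ℕ => if n.Prime then log (1 - 1 / (n : ℝ)) else 0) (Nat.zero_le M) hMN
  have e : (∑ n ∈ Ioc 0 N, (if n.Prime then log (1 - 1 / (n : ℝ)) else 0) + log (log N)) -
        (∑ n ∈ Ioc 0 M, (if n.Prime then log (1 - 1 / (n : ℝ)) else 0) + log (log M)) =
      ∑ p ∈ (Ioc M N).filter Nat.Prime, log (1 - 1 / (p : ℝ)) + (log (log N) - log (log M)) := by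
    rw [sum_filter, ← hsum]
    ring
  rw [e, exp_add, exp_sub, exp_log hlM, exp_log hlN, exp_sum, mul_assoc]
  have : log N / log M * (log M / log N) = 1 := by field_simp
  rw [this, mul_one]
  refine prod_congr rfl fun p hp => ?_
  have hp2 : (2 : ℝ) ≤ p := by exact_mod_cast (mem_filter.1 hp).2.two_le
  have h1 : (1 : ℝ) / p < 1 := by rw [div_lt_one (by linarith)]; linarith
  rw [exp_log (by linarith)]
  field_simp

open Real in
lemma tendsto_log_div_log_floor :
    Tendsto (fun y : ℝ => log y / log (⌊y⌋₊ : ℝ)) atTop (nhds 1) := by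
  have h1 : Tendsto (fun y : ℝ => log ((⌊y⌋₊ : ℝ) / y)) atTop (nhds 0) := by
    rw [← log_one]
    exact (tendsto_nat_floor_div_atTop (R := ℝ)).log one_ne_zero
  have h2 := ((h1.div_atTop tendsto_log_atTop).const_add 1).inv₀ (by norm_num)
  rw [add_zero, inv_one] at h2
  refine h2.congr' ?_
  filter_upwards [eventually_ge_atTop 2] with y hy
  have hf : 0 < ⌊y⌋₊ := Nat.floor_pos.2 (by linarith)
  have hy0 : 0 < log y := log_pos (by linarith)
  rw [log_div (by positivity) (by positivity), ← inv_div]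
  field_simp
  ring

/-- For every real `c` with `1/2 ≤ c ≤ 1`,
`n · ∏_{p prime, pₙ < p ≤ (pₙ#)^c} (p−1)/p → 1/c` as `n → ∞`. -/
theorem statement0 (c : ℝ) (hc₁ : 1 / 2 ≤ c) (hc₂ : c ≤ 1) :
    Tendsto (fun n : ℕ =>
      (n : ℝ) *
        ∏ p ∈ (Finset.range (Nat.floor ((primorial' n : ℝ) ^ c) + 1)).filter
            (fun p => p.Prime ∧ nthPrime n < p ∧ (p : ℝ) ≤ (primorial' n : ℝ) ^ c),
          ((p : ℝ) - 1) / p)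
      atTop (nhds (1 / c)) := by
  have hc0 : 0 < c := by linarith
  rw [← tendsto_add_atTop_iff_nat 1]
  set P : ℕ → ℕ := Nat.nth Nat.Prime with hP
  set y : ℕ → ℝ := fun n => (primorial' (n + 1) : ℝ) ^ c with hy
  have hPtop : Tendsto P atTop atTop :=
    tendsto_atTop_mono (fun n => (Nat.le_add_right n 2).trans (Nat.add_two_le_nth_prime n)) tendsto_id
  have hpos : ∀ n, 0 < primorial' n := fun n => prod_pos fun i _ => (Nat.prime_nth_prime i).pos
  have hypos : ∀ n, 0 < y n := fun n => Real.rpow_pos_of_pos (by exact_mod_cast hpos _) c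
  have hlogy : ∀ n, Real.log (y n) = c * Chebyshev.theta (P n) := fun n => by
    rw [hy, Real.log_rpow (by exact_mod_cast hpos _), log_primorial']
  have hle : ∀ᶠ n in atTop, (P n : ℝ) ≤ y n := by
    have h := Real.isLittleO_log_id_atTop.bound (c := 1 / 4) (by norm_num)
    filter_upwards [hPtop.eventually eventually_half_le_theta,
      hPtop.eventually (tendsto_natCast_atTop_atTop.eventually h)] with n h1 h2
    have hP0 : (0 : ℝ) < P n := by exact_mod_cast (Nat.prime_nth_prime n).pos
    rw [← Real.log_le_log_iff hP0 (hypos n), hlogy]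
    rw [Real.norm_of_nonneg (Real.log_natCast_nonneg _), id,
      Real.norm_of_nonneg hP0.le] at h2
    nlinarith
  have hytop : Tendsto y atTop atTop :=
    tendsto_atTop_mono' _ hle (tendsto_natCast_atTop_atTop.comp hPtop)
  obtain ⟨l, hl⟩ := exists_tendsto_sum_log_one_sub_inv_add_log_log
  have hexp := Real.continuous_exp.continuousAt.tendsto.comp
    ((hl.comp (tendsto_nat_floor_atTop.comp hytop)).sub (hl.comp hPtop))
  rw [sub_self, Real.exp_zero] at hexp
  have hlim := (hexp.mul ((tendsto_primeCounting_mul_log_div_theta.comp hPtop).mul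
    (tendsto_log_div_log_floor.comp hytop))).mul_const (1 / c)
  rw [mul_one, mul_one, one_mul] at hlim
  refine hlim.congr' ?_
  filter_upwards [hle, hytop.eventually_gt_atTop 1] with n hn h1
  have hfilter : (Finset.range (Nat.floor (y n) + 1)).filter
      (fun p => p.Prime ∧ nthPrime (n + 1) < p ∧ (p : ℝ) ≤ y n) =
      (Ioc (P n) ⌊y n⌋₊).filter Nat.Prime := by
    ext p
    rw [mem_filter, mem_filter, mem_range, mem_Ioc, nthPrime_add_one, Nat.lt_succ_iff,
      Nat.le_floor_iff (hypos n).le]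
    tauto
  have hθ : c * Chebyshev.theta (P n) ≠ 0 := by
    rw [← hlogy]
    exact (Real.log_pos h1).ne'
  have hθ' := right_ne_zero_of_mul hθ
  change _ = _ * ∏ p ∈ (Finset.range (Nat.floor (y n) + 1)).filter
      (fun p => p.Prime ∧ nthPrime (n + 1) < p ∧ (p : ℝ) ≤ y n), _
  rw [hfilter, prod_prime_one_sub_inv_eq (M := P n) (Nat.prime_nth_prime n).two_le (Nat.le_floor hn)]
  simp only [Function.comp_apply, hlogy]
  rw [show Nat.primeCounting (P n) = n + 1 from primeCounting_nth_prime n]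
  field_simp
end

section
/- For every real x ≥ 599, |1/π(x) − (log x)/ϑ(x)| < 0.30543 · (log x)/ϑ(x); equivalently, |ϑ(x)/(π(x) · log x) − 1| < 0.30543. -/
open Finset

/-- `primePi x` is π(x), the number of primes `p ≤ x`. -/
noncomputable def primePi (x : ℝ) : ℕ :=
  ((Finset.range (Nat.floor x + 1)).filter (fun p : ℕ => p.Prime ∧ (p : ℝ) ≤ x)).card

/-- `theta x` is Chebyshev's function ϑ(x) = ∑_{p prime, p ≤ x} log p. -/
noncomputable def theta (x : ℝ) : ℝ :=
  ∑ p ∈ (Finset.range (Nat.floor x + 1)).filter (fun p : ℕ => p.Prime ∧ (p : ℝ) ≤ x),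
    Real.log p

/-! ### Computing with primes below `8281 = 91 ^ 2` -/

/-- A primality test, valid below `91 ^ 2`, that reduces well in the kernel. -/
def gcdPrimeTest (n : ℕ) : Bool :=
  bif n.ble 90 then Nat.ble 2 n && (n.gcd (n - 1).factorial).beq 1
  else (n.gcd (Nat.factorial 90)).beq 1

theorem Nat.Prime.of_coprime_factorial {n m : ℕ} (hn : 2 ≤ n) (hm : n < (m + 1) ^ 2)
    (h : n.Coprime m.factorial) : n.Prime := by
  by_contra hp
  have h1 := Nat.minFac_sq_le_self (by lia) hp
  have h2 : n.minFac ≤ m := by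
    have := lt_of_pow_lt_pow_left₀ 2 (by lia) (h1.trans_lt hm)
    lia
  have h3 := Nat.dvd_gcd n.minFac_dvd (Nat.dvd_factorial n.minFac_pos h2)
  rw [h, Nat.dvd_one, Nat.minFac_eq_one_iff] at h3
  lia

theorem Nat.Prime.coprime_factorial {n m : ℕ} (hn : n.Prime) (h : m < n) :
    n.Coprime m.factorial := by
  rw [Nat.Prime.coprime_iff_not_dvd hn, hn.dvd_factorial]
  lia

theorem gcdPrimeTest_iff {n : ℕ} (hn : n < 8281) : gcdPrimeTest n = true ↔ n.Prime := by
  rcases le_or_gt n 90 with h | h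
  · have hb : n.ble 90 = true := by simpa using h
    simp only [gcdPrimeTest, hb, cond_true, Bool.and_eq_true, Nat.ble_eq, Nat.beq_eq]
    refine ⟨fun ⟨h2, hc⟩ ↦ .of_coprime_factorial h2 ?_ hc, fun hp ↦
      ⟨hp.two_le, hp.coprime_factorial (Nat.sub_lt hp.pos one_pos)⟩⟩
    rw [Nat.sub_add_cancel (by lia)]
    exact lt_self_pow₀ h2 one_lt_two
  · have hb : n.ble 90 = false := by rwa [← Bool.not_eq_true, Nat.ble_eq, not_le]
    simp only [gcdPrimeTest, hb, cond_false, Nat.beq_eq]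
    exact ⟨fun hc ↦ .of_coprime_factorial (by lia) (by simpa using hn) hc,
      fun hp ↦ hp.coprime_factorial h⟩

/-- The number of primes in `[l, l + 2 ^ k)`. -/
def dyadicPrimeCount : ℕ → ℕ → ℕ
  | 0, l => bif gcdPrimeTest l then 1 else 0
  | k + 1, l => dyadicPrimeCount k l + dyadicPrimeCount k (l + 2 ^ k)

/-- The product of the primes in `[l, l + 2 ^ k)`. -/
def dyadicPrimeProd : ℕ → ℕ → ℕ
  | 0, l => bif gcdPrimeTest l then l else 1
  | k + 1, l => dyadicPrimeProd k l * dyadicPrimeProd k (l + 2 ^ k)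

/-- The number of primes below `64 * m`. -/
def blockPrimeCount : ℕ → ℕ
  | 0 => 0
  | m + 1 => blockPrimeCount m + dyadicPrimeCount 6 (64 * m)

/-- The product of the primes below `64 * m`. -/
def blockPrimeProd : ℕ → ℕ
  | 0 => 1
  | m + 1 => blockPrimeProd m * dyadicPrimeProd 6 (64 * m)

theorem dyadicPrimeCount_eq (k l : ℕ) (h : l + 2 ^ k ≤ 8281) :
    dyadicPrimeCount k l = ∑ n ∈ Ico l (l + 2 ^ k), if n.Prime then 1 else 0 := by
  induction k generalizing l with
  | zero =>
    have := gcdPrimeTest_iff (n := l) (by simpa using h)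
    by_cases hp : l.Prime <;> simp_all [dyadicPrimeCount, Finset.filter_singleton]
  | succ k ih =>
    have h' : l + 2 ^ k + 2 ^ k ≤ 8281 := by rw [pow_succ] at h; lia
    rw [dyadicPrimeCount, ih l (by lia), ih _ h', Finset.sum_Ico_consecutive _ (by lia) (by lia),
      pow_succ, mul_two, add_assoc]

theorem dyadicPrimeProd_eq (k l : ℕ) (h : l + 2 ^ k ≤ 8281) :
    dyadicPrimeProd k l = ∏ n ∈ Ico l (l + 2 ^ k), if n.Prime then n else 1 := by
  induction k generalizing l with
  | zero =>
    have := gcdPrimeTest_iff (n := l) (by simpa using h)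
    by_cases hp : l.Prime <;> simp_all [dyadicPrimeProd]
  | succ k ih =>
    have h' : l + 2 ^ k + 2 ^ k ≤ 8281 := by rw [pow_succ] at h; lia
    rw [dyadicPrimeProd, ih l (by lia), ih _ h', Finset.prod_Ico_consecutive _ (by lia) (by lia),
      pow_succ, mul_two, add_assoc]

theorem blockPrimeCount_eq {m : ℕ} (hm : m ≤ 129) :
    blockPrimeCount m = #(Nat.primesBelow (64 * m)) := by
  rw [Nat.primesBelow, Finset.card_filter]
  induction m with
  | zero => simp [blockPrimeCount]
  | succ m ih =>
    rw [blockPrimeCount, ih (by lia), dyadicPrimeCount_eq 6 _ (by lia),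
      Finset.range_eq_Ico, Finset.sum_Ico_consecutive _ (by lia) (by lia),
      show 64 * (m + 1) = 64 * m + 2 ^ 6 by lia, Finset.range_eq_Ico]

theorem blockPrimeProd_eq {m : ℕ} (hm : m ≤ 129) :
    blockPrimeProd m = ∏ p ∈ Nat.primesBelow (64 * m), p := by
  rw [Nat.primesBelow, Finset.prod_filter]
  induction m with
  | zero => simp [blockPrimeProd]
  | succ m ih =>
    rw [blockPrimeProd, ih (by lia), dyadicPrimeProd_eq 6 _ (by lia),
      Finset.range_eq_Ico, Finset.prod_Ico_consecutive _ (by lia) (by lia),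
      show 64 * (m + 1) = 64 * m + 2 ^ 6 by lia, Finset.range_eq_Ico]

/-! ### Reduction to Mathlib's functions -/

theorem filter_prime_cast_le_eq_primesLE (x : ℝ) (hx : 0 ≤ x) :
    (range (⌊x⌋₊ + 1)).filter (fun p : ℕ => p.Prime ∧ (p : ℝ) ≤ x) = Nat.primesLE ⌊x⌋₊ := by
  rw [Nat.primesLE_eq_filter_range]
  refine Finset.filter_congr fun p hp ↦ and_iff_left ?_
  rw [← Nat.le_floor_iff hx]
  simpa [Nat.lt_succ_iff] using hp

theorem primePi_eq_card {x : ℝ} (hx : 0 ≤ x) : primePi x = #(Nat.primesLE ⌊x⌋₊) := by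
  rw [primePi, filter_prime_cast_le_eq_primesLE x hx]

theorem primePi_eq {x : ℝ} (hx : 0 ≤ x) : primePi x = Nat.primeCounting ⌊x⌋₊ := by
  rw [primePi_eq_card hx, Nat.primesLE_eq_filter_range, Nat.primeCounting, Nat.primeCounting',
    Nat.count_eq_card_filter_range]

theorem theta_eq {x : ℝ} (hx : 0 ≤ x) : theta x = Chebyshev.theta x := by
  rw [theta, filter_prime_cast_le_eq_primesLE x hx, Chebyshev.theta_eq_sum_primesLE]

/-- `π(x) log x - ϑ(x)` as a sum over primes. -/
theorem primePi_mul_log_sub_theta {x : ℝ} (hx : 0 ≤ x) :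
    primePi x * Real.log x - theta x = ∑ p ∈ Nat.primesLE ⌊x⌋₊, (Real.log x - Real.log p) := by
  rw [Finset.sum_sub_distrib, Finset.sum_const, nsmul_eq_mul, primePi_eq_card hx, theta_eq hx,
    Chebyshev.theta_eq_sum_primesLE]

/-! ### Small arguments -/

theorem sub_theta_lt_of_blockPrime {x : ℝ} {a b : ℕ} (ha : 0 < a) (hb : b ≤ 129)
    (hab : a ≤ b)
    (hax : (64 * a : ℕ) ≤ x) (hxb : x ≤ (64 * b : ℕ))
    (hcheck : (64 * b) ^ (10 * blockPrimeCount b) <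
      blockPrimeProd b ^ 10 * (64 * a) ^ (3 * blockPrimeCount a)) :
    primePi x * Real.log x - theta x <
      0.3 * (#(Nat.primesBelow (64 * a)) * Real.log (64 * a : ℕ)) := by
  have hx : 0 < x := lt_of_lt_of_le (by positivity) hax
  have hsub : Nat.primesLE ⌊x⌋₊ ⊆ Nat.primesBelow (64 * b) := by
    intro p hp
    rw [Nat.mem_primesLE] at hp
    rw [Nat.mem_primesBelow]
    refine ⟨lt_of_le_of_ne (hp.1.trans (Nat.floor_le_of_le hxb)) ?_, hp.2⟩
    rintro rfl
    exact Nat.not_prime_mul (by lia) (by rintro rfl; exact absurd hp.2 (by norm_num)) hp.2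
  rw [blockPrimeCount_eq hb, blockPrimeProd_eq hb, blockPrimeCount_eq (hab.trans hb)] at hcheck
  have hprod : (0 : ℝ) < ∏ p ∈ Nat.primesBelow (64 * b), (p : ℝ) :=
    Finset.prod_pos fun p hp ↦ by exact_mod_cast (Nat.prime_of_mem_primesBelow hp).pos
  have hlog : ∑ p ∈ Nat.primesBelow (64 * b), Real.log p =
      Real.log (∏ p ∈ Nat.primesBelow (64 * b), (p : ℝ)) :=
    (Real.log_prod fun p hp ↦ by exact_mod_cast (Nat.prime_of_mem_primesBelow hp).ne_zero).symm
  have ha' : (0 : ℝ) < (64 * a : ℕ) := by positivity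
  have hb' : (0 : ℝ) < (64 * b : ℕ) := by
    have : 0 < b := by lia
    positivity
  have key : ((64 * b : ℕ) : ℝ) ^ (10 * #(Nat.primesBelow (64 * b))) <
      (∏ p ∈ Nat.primesBelow (64 * b), (p : ℝ)) ^ 10 *
        ((64 * a : ℕ) : ℝ) ^ (3 * #(Nat.primesBelow (64 * a))) := by
    rw [← Nat.cast_prod]
    exact_mod_cast hcheck
  have key' := Real.log_lt_log (pow_pos hb' _) key
  rw [Real.log_mul (pow_pos hprod _).ne' (pow_pos ha' _).ne', Real.log_pow, Real.log_pow,
    Real.log_pow, ← hlog] at key'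
  have hle : ∑ p ∈ Nat.primesLE ⌊x⌋₊, (Real.log x - Real.log p) ≤
      ∑ p ∈ Nat.primesBelow (64 * b), (Real.log (64 * b : ℕ) - Real.log p) := by
    refine (Finset.sum_le_sum fun p _ ↦ sub_le_sub_right (Real.log_le_log hx hxb) _).trans
      (Finset.sum_le_sum_of_subset_of_nonneg hsub fun p hp _ ↦ sub_nonneg.2 ?_)
    rw [Nat.mem_primesBelow] at hp
    exact Real.log_le_log (by exact_mod_cast hp.2.pos) (by exact_mod_cast hp.1.le)
  rw [← primePi_mul_log_sub_theta hx.le, Finset.sum_sub_distrib, Finset.sum_const,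
    nsmul_eq_mul] at hle
  push_cast at key' hle ⊢
  linarith

theorem blockPrimeCount_lt_576_832 : (64 * 13) ^ (10 * blockPrimeCount 13) <
    blockPrimeProd 13 ^ 10 * (64 * 9) ^ (3 * blockPrimeCount 9) := by
  decide +kernel

theorem blockPrimeCount_lt_832_1216 : (64 * 19) ^ (10 * blockPrimeCount 19) <
    blockPrimeProd 19 ^ 10 * (64 * 13) ^ (3 * blockPrimeCount 13) := by
  decide +kernel

theorem blockPrimeCount_lt_1216_1984 : (64 * 31) ^ (10 * blockPrimeCount 31) <
    blockPrimeProd 31 ^ 10 * (64 * 19) ^ (3 * blockPrimeCount 19) := by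
  decide +kernel

theorem blockPrimeCount_lt_1984_3392 : (64 * 53) ^ (10 * blockPrimeCount 53) <
    blockPrimeProd 53 ^ 10 * (64 * 31) ^ (3 * blockPrimeCount 31) := by
  decide +kernel

theorem blockPrimeCount_lt_3392_4096 : (64 * 64) ^ (10 * blockPrimeCount 64) <
    blockPrimeProd 64 ^ 10 * (64 * 53) ^ (3 * blockPrimeCount 53) := by
  decide +kernel

theorem blockPrimeCount_lt_4096_8192 : (64 * 128) ^ (10 * blockPrimeCount 128) <
    blockPrimeProd 128 ^ 10 * (64 * 64) ^ (3 * blockPrimeCount 64) := by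
  decide +kernel

theorem card_primesBelow_mul_log_le {x : ℝ} {n : ℕ} (hn : 0 < n) (hnx : n ≤ x) :
    #(Nat.primesBelow n) * Real.log n ≤ primePi x * Real.log x := by
  have hn' : (1 : ℝ) ≤ n := by exact_mod_cast hn
  rw [primePi_eq_card (by linarith)]
  have hcard : #(Nat.primesBelow n) ≤ #(Nat.primesLE ⌊x⌋₊) := by
    refine Finset.card_le_card fun p hp ↦ ?_
    rw [Nat.mem_primesBelow] at hp
    exact Nat.mem_primesLE.2 ⟨hp.1.le.trans (Nat.le_floor hnx), hp.2⟩
  have := Real.log_nonneg hn'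
  have := Real.log_le_log (by linarith) hnx
  gcongr

theorem sub_theta_lt_of_le {x : ℝ} (hx : 576 ≤ x) (hx' : x ≤ 8192) :
    primePi x * Real.log x - theta x < 0.3 * (primePi x * Real.log x) := by
  have step : ∀ a b : ℕ, 0 < a → a ≤ b → b ≤ 129 → (64 * a : ℕ) ≤ x → x ≤ (64 * b : ℕ) →
      (64 * b) ^ (10 * blockPrimeCount b) <
        blockPrimeProd b ^ 10 * (64 * a) ^ (3 * blockPrimeCount a) →
      primePi x * Real.log x - theta x < 0.3 * (primePi x * Real.log x) := by
    intro a b ha hab hb hax hxb h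
    have h1 := sub_theta_lt_of_blockPrime ha hb hab hax hxb h
    have h2 := card_primesBelow_mul_log_le (by lia) hax
    linarith
  rcases le_total x 832 with h1 | h1
  · exact step 9 13 (by lia) (by lia) (by lia) (by norm_num; exact hx) (by norm_num; exact h1)
      blockPrimeCount_lt_576_832
  rcases le_total x 1216 with h2 | h2
  · exact step 13 19 (by lia) (by lia) (by lia) (by norm_num; exact h1) (by norm_num; exact h2)
      blockPrimeCount_lt_832_1216
  rcases le_total x 1984 with h3 | h3
  · exact step 19 31 (by lia) (by lia) (by lia) (by norm_num; exact h2) (by norm_num; exact h3)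
      blockPrimeCount_lt_1216_1984
  rcases le_total x 3392 with h4 | h4
  · exact step 31 53 (by lia) (by lia) (by lia) (by norm_num; exact h3) (by norm_num; exact h4)
      blockPrimeCount_lt_1984_3392
  rcases le_total x 4096 with h5 | h5
  · exact step 53 64 (by lia) (by lia) (by lia) (by norm_num; exact h4) (by norm_num; exact h5)
      blockPrimeCount_lt_3392_4096
  · exact step 64 128 (by lia) (by lia) (by lia) (by norm_num; exact h5) (by norm_num; exact hx')
      blockPrimeCount_lt_4096_8192

/-! ### Large arguments -/

theorem log_8192 : Real.log 8192 = 13 * Real.log 2 := by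
  rw [show (8192 : ℝ) = 2 ^ 13 by norm_num, Real.log_pow]
  norm_num

theorem nine_lt_log {x : ℝ} (hx : 8192 ≤ x) : 9 < Real.log x := by
  have := Real.log_le_log (by norm_num) hx
  rw [log_8192] at this
  linarith [Real.log_two_gt_d9]

/-- An upper approximation to an antiderivative of `1 / log² t`. -/
noncomputable def invLogSqPrimitive (t : ℝ) : ℝ :=
  t / Real.log t ^ 2 + 3 * t / Real.log t ^ 3

theorem hasDerivAt_invLogSqPrimitive {t : ℝ} (ht : 1 < t) :
    HasDerivAt invLogSqPrimitive
      (1 / Real.log t ^ 2 + 1 / Real.log t ^ 3 - 9 / Real.log t ^ 4) t := by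
  have hl : Real.log t ≠ 0 := (Real.log_pos ht).ne'
  have ht0 : t ≠ 0 := by linarith
  have hlog := Real.hasDerivAt_log ht0
  have h := ((hasDerivAt_id t).div (hlog.pow 2) (pow_ne_zero 2 hl)).add
    (((hasDerivAt_id t).const_mul 3).div (hlog.pow 3) (pow_ne_zero 3 hl))
  refine h.congr_deriv ?_
  simp
  field_simp
  ring

theorem integral_theta_div_le {x : ℝ} (hx : 8192 ≤ x) :
    ∫ t in (8192 : ℝ)..x, Chebyshev.theta t / (t * Real.log t ^ 2) ≤
      Real.log 4 * invLogSqPrimitive x - Real.log 4 * invLogSqPrimitive 8192 := by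
  have hderiv : ∀ t : ℝ, 8192 ≤ t → HasDerivAt (fun t ↦ Real.log 4 * invLogSqPrimitive t) _ t :=
    fun t ht ↦ (hasDerivAt_invLogSqPrimitive (by linarith)).const_mul (Real.log 4)
  refine intervalIntegral.integral_le_sub_of_hasDeriv_right_of_le hx
    (fun t ht ↦ (hderiv t ht.1).continuousAt.continuousWithinAt)
    (fun t ht ↦ (hderiv t ht.1.le).hasDerivWithinAt)
    ((Chebyshev.integrableOn_theta_div_id_mul_log_sq x).mono_set
      (Set.Icc_subset_Icc_left (by norm_num))) fun t ht ↦ ?_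
  have h9 := nine_lt_log ht.1.le
  have ht0 : 0 < t := by linarith [ht.1]
  have hl4 : 0 < Real.log 4 := Real.log_pos (by norm_num)
  calc Chebyshev.theta t / (t * Real.log t ^ 2)
      ≤ Real.log 4 * t / (t * Real.log t ^ 2) := by
        gcongr
        exact Chebyshev.theta_le_log4_mul_x ht0.le
    _ = Real.log 4 * (1 / Real.log t ^ 2) := by field_simp
    _ ≤ _ := by
        gcongr
        have : 9 / Real.log t ^ 4 ≤ 1 / Real.log t ^ 3 := by
          rw [div_le_div_iff₀ (by positivity) (by positivity)]
          nlinarith [pow_pos (show 0 < Real.log t by linarith) 3]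
        linarith

theorem log_four : Real.log 4 = 2 * Real.log 2 := by
  rw [show (4 : ℝ) = 2 ^ 2 by norm_num, Real.log_pow]
  norm_num

theorem card_primesBelow_4096 : #(Nat.primesBelow 4096) = 564 := by
  rw [← blockPrimeCount_eq (m := 64) (by lia)]
  decide +kernel

theorem sub_theta_div_log_8192_le :
    Nat.primeCounting ⌊(8192 : ℝ)⌋₊ - Chebyshev.theta 8192 / Real.log 8192 ≤
      Real.log 4 * invLogSqPrimitive 8192 := by
  have h := sub_theta_lt_of_blockPrime (x := 8192) (a := 64) (b := 128) (by lia) (by lia) (by lia)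
    (by norm_num) (by norm_num) blockPrimeCount_lt_4096_8192
  rw [primePi_eq (by norm_num), theta_eq (by norm_num)] at h
  norm_num only [card_primesBelow_4096] at h
  have h12 : Real.log 4096 = 12 * Real.log 2 := by
    rw [show (4096 : ℝ) = 2 ^ 12 by norm_num, Real.log_pow]
    norm_num
  rw [h12] at h
  have hl := Real.log_two_gt_d9
  have hl' := Real.log_two_lt_d9
  have h0 : 0 < Real.log 8192 := by rw [log_8192]; linarith
  have h1 : (Nat.primeCounting ⌊(8192 : ℝ)⌋₊ - Chebyshev.theta 8192 / Real.log 8192 : ℝ) ≤ 157 := by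
    rw [← mul_le_mul_iff_left₀ h0, sub_mul, div_mul_cancel₀ _ h0.ne']
    norm_num only [Nat.floor_ofNat] at h ⊢
    rw [log_8192] at h ⊢
    linarith
  refine h1.trans ?_
  rw [invLogSqPrimitive, log_8192, log_four]
  generalize Real.log 2 = l at hl hl'
  have hl0 : 0 < l := by linarith
  have : 2 * l * (8192 / (13 * l) ^ 2 + 3 * 8192 / (13 * l) ^ 3) =
      (2 * 8192 / 169) / l + (6 * 8192 / 2197) / l ^ 2 := by
    field_simp
    ring
  rw [this]
  have e1 : (2 * 8192 / 169 : ℝ) / 0.7 ≤ (2 * 8192 / 169) / l := by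
    gcongr
    linarith
  have e2 : (6 * 8192 / 2197 : ℝ) / 0.7 ^ 2 ≤ (6 * 8192 / 2197) / l ^ 2 := by
    gcongr
    linarith
  norm_num at e1 e2 ⊢
  linarith

theorem sub_theta_le_of_ge {x : ℝ} (hx : 8192 ≤ x) :
    primePi x * Real.log x - theta x ≤ Real.log x * (Real.log 4 * invLogSqPrimitive x) := by
  have h9 := nine_lt_log hx
  have hx0 : 0 ≤ x := by linarith
  rw [primePi_eq hx0, theta_eq hx0]
  have hint : ∀ y : ℝ, 2 ≤ y → IntervalIntegrable
      (fun t ↦ Chebyshev.theta t / (t * Real.log t ^ 2)) MeasureTheory.volume 2 y := fun y hy ↦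
    (intervalIntegrable_iff_integrableOn_Icc_of_le hy).2
      (Chebyshev.integrableOn_theta_div_id_mul_log_sq y)
  have h1 := Chebyshev.primeCounting_eq_theta_div_log_add_integral (x := x) (by linarith)
  have h2 := Chebyshev.primeCounting_eq_theta_div_log_add_integral (x := 8192) (by norm_num)
  have h3 := intervalIntegral.integral_add_adjacent_intervals (hint 8192 (by norm_num))
    ((hint 8192 (by norm_num)).symm.trans (hint x (by linarith)))
  have h4 := integral_theta_div_le hx
  have h5 := sub_theta_div_log_8192_le
  have h6 : (Nat.primeCounting ⌊x⌋₊ - Chebyshev.theta x / Real.log x : ℝ) ≤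
      Real.log 4 * invLogSqPrimitive x := by linarith
  calc _ = Real.log x * (Nat.primeCounting ⌊x⌋₊ - Chebyshev.theta x / Real.log x : ℝ) := by
        field_simp
    _ ≤ _ := by gcongr

theorem sub_theta_lt_of_ge {x : ℝ} (hx : 8192 ≤ x) :
    primePi x * Real.log x - theta x < 0.30543 * (primePi x * Real.log x) := by
  have h9 := nine_lt_log hx
  have hl := Real.log_two_gt_d9
  have hl' := Real.log_two_lt_d9
  refine (sub_theta_le_of_ge hx).trans_lt ?_
  have hup : Real.log x * (Real.log 4 * invLogSqPrimitive x) ≤ 8 / 27 * Real.log 2 * x := by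
    have e : Real.log x * (Real.log 4 * invLogSqPrimitive x) =
        2 * Real.log 2 * x * (1 / Real.log x + 3 * (1 / Real.log x) ^ 2) := by
      rw [log_four, invLogSqPrimitive]
      field_simp
    have h1 : 1 / Real.log x ≤ 1 / 9 := by gcongr
    have h2 : 0 ≤ 1 / Real.log x := by positivity
    have h3 : 1 / Real.log x + 3 * (1 / Real.log x) ^ 2 ≤ 4 / 27 := by nlinarith
    rw [e]
    have : 0 ≤ 2 * Real.log 2 * x := by positivity
    nlinarith
  have hlow : (x - 1) * Real.log 2 - Real.log (x + 2) ≤ primePi x * Real.log x := by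
    have := Chebyshev.pi_ge' (x := x) (by linarith)
    rwa [div_le_iff₀ (by linarith), ← primePi_eq (by linarith)] at this
  have hlog : Real.log (x + 2) ≤ (x + 2) / 8192 - 1 + 13 * Real.log 2 := by
    have h := Real.log_le_sub_one_of_pos (x := (x + 2) / 8192) (by linarith)
    rw [Real.log_div (by linarith) (by norm_num), log_8192] at h
    linarith
  nlinarith

theorem statement2 (x : ℝ) (hx : 599 ≤ x) :
    |1 / (primePi x : ℝ) - Real.log x / theta x| < (0.30543 : ℝ) * (Real.log x / theta x) := by
  have hx0 : 0 ≤ x := by linarith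
  have hlog : 0 < Real.log x := Real.log_pos (by linarith)
  have hθ : 0 < theta x := by
    rw [theta_eq hx0]
    exact Chebyshev.theta_pos (by linarith)
  have hle : theta x ≤ primePi x * Real.log x := by
    rw [theta_eq hx0, primePi_eq hx0]
    exact Chebyshev.theta_le_pi_mul_log' x
  have hπ : (0 : ℝ) < primePi x := pos_of_mul_pos_left (hθ.trans_le hle) hlog.le
  have hlt : primePi x * Real.log x - theta x < 0.30543 * (primePi x * Real.log x) := by
    rcases le_total x 8192 with h | h
    · have := sub_theta_lt_of_le (by linarith) h
      have : 0 < primePi x * Real.log x := by positivity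
      linarith
    · exact sub_theta_lt_of_ge h
  have e : 1 / (primePi x : ℝ) - Real.log x / theta x =
      -((primePi x * Real.log x - theta x) / (primePi x * theta x)) := by
    field_simp
    ring
  rw [e, abs_neg, abs_of_nonneg (div_nonneg (by linarith) (by positivity)),
    div_lt_iff₀ (by positivity)]
  refine hlt.trans_eq ?_
  field_simp
end

section
/- For every integer n such that p_n ≥ 599, one has log log(p_n#) − 0.1334 < log p_n < log log(p_n#) + 0.15398. -/
open Finset

section

open ArithmeticFunction Chebyshev

theorem log_factorial_eq_sum_vonMangoldt {n N : ℕ} (h : n ≤ N) :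
    Real.log n.factorial = ∑ d ∈ Ioc 0 N, Λ d * (n / d : ℕ) := by
  induction n with
  | zero => simp
  | succ n ih =>
    rw [Nat.factorial_succ, Nat.cast_mul, Real.log_mul (by positivity) (by positivity),
      ih (by omega), ← vonMangoldt_sum]
    have : (n + 1).divisors = (Ioc 0 N).filter (· ∣ n + 1) := by
      ext d
      simp only [Nat.mem_divisors, mem_filter, mem_Ioc]
      constructor
      · rintro ⟨hd, -⟩
        exact ⟨⟨Nat.pos_of_dvd_of_pos hd (by omega), (Nat.le_of_dvd (by omega) hd).trans h⟩, hd⟩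
      · rintro ⟨-, hd⟩
        exact ⟨hd, by omega⟩
    rw [this, sum_filter, ← sum_add_distrib]
    refine sum_congr rfl fun d _ => ?_
    rw [Nat.succ_div]
    split_ifs <;> push_cast <;> ring

theorem psi_natCast (n : ℕ) : ψ n = ∑ d ∈ Ioc 0 n, Λ d := by simp [psi]

theorem chebyshev_coefficient_le_one (k : ℕ) : k + k / 30 ≤ k / 2 + k / 3 + k / 5 + 1 := by omega

theorem chebyshev_coefficient_nonneg (k : ℕ) : k / 2 + k / 3 + k / 5 ≤ k + k / 30 := by omega

theorem one_le_chebyshev_coefficient {k : ℕ} (hk : 0 < k) (hk6 : k < 6) :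
    k / 2 + k / 3 + k / 5 + 1 ≤ k + k / 30 := by omega

/-- The logarithm of Chebyshev's integer `(30m)! m! / ((15m)! (10m)! (6m)!)`. -/
noncomputable def logFactorialRatio (m : ℕ) : ℝ :=
  Real.log (30 * m).factorial + Real.log m.factorial - Real.log (15 * m).factorial
    - Real.log (10 * m).factorial - Real.log (6 * m).factorial

theorem logFactorialRatio_eq_sum (m : ℕ) : logFactorialRatio m =
    ∑ d ∈ Ioc 0 (30 * m), Λ d * ((30 * m / d : ℕ) + (30 * m / d / 30 : ℕ) -
      (30 * m / d / 2 : ℕ) - (30 * m / d / 3 : ℕ) - (30 * m / d / 5 : ℕ) : ℝ) := by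
  have div_eq (d j i : ℕ) (hj : 0 < j) (h : j * i = 30) : 30 * m / d / j = i * m / d := by
    rw [Nat.div_div_eq_div_mul, mul_comm d j, ← Nat.div_div_eq_div_mul, ← h, mul_assoc,
      Nat.mul_div_cancel_left _ hj]
  simp only [div_eq _ 30 1 (by norm_num) rfl, div_eq _ 2 15 (by norm_num) rfl,
    div_eq _ 3 10 (by norm_num) rfl, div_eq _ 5 6 (by norm_num) rfl, one_mul]
  rw [logFactorialRatio, log_factorial_eq_sum_vonMangoldt le_rfl,
    log_factorial_eq_sum_vonMangoldt (show m ≤ 30 * m by omega),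
    log_factorial_eq_sum_vonMangoldt (show 15 * m ≤ 30 * m by omega),
    log_factorial_eq_sum_vonMangoldt (show 10 * m ≤ 30 * m by omega),
    log_factorial_eq_sum_vonMangoldt (show 6 * m ≤ 30 * m by omega)]
  simp only [← sum_add_distrib, ← sum_sub_distrib]
  refine sum_congr rfl fun d _ => by ring

theorem logFactorialRatio_le_psi (m : ℕ) : logFactorialRatio m ≤ ψ (30 * m : ℕ) := by
  rw [logFactorialRatio_eq_sum, psi_natCast]
  refine sum_le_sum fun d _ => mul_le_of_le_one_right vonMangoldt_nonneg ?_
  have := chebyshev_coefficient_le_one (30 * m / d)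
  have : ((30 * m / d : ℕ) + (30 * m / d / 30 : ℕ) : ℝ) ≤
      (30 * m / d / 2 : ℕ) + (30 * m / d / 3 : ℕ) + (30 * m / d / 5 : ℕ) + 1 := mod_cast this
  linarith

theorem psi_sub_psi_le_logFactorialRatio (m : ℕ) :
    ψ (30 * m : ℕ) - ψ (5 * m : ℕ) ≤ logFactorialRatio m := by
  rw [logFactorialRatio_eq_sum, psi_natCast, psi_natCast, sub_le_iff_le_add,
    ← sum_Ioc_consecutive _ (Nat.zero_le (5 * m)) (show 5 * m ≤ 30 * m by omega),
    ← sum_Ioc_consecutive _ (Nat.zero_le (5 * m)) (show 5 * m ≤ 30 * m by omega)]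
  have h₁ : 0 ≤ ∑ d ∈ Ioc 0 (5 * m), Λ d * ((30 * m / d : ℕ) + (30 * m / d / 30 : ℕ) -
      (30 * m / d / 2 : ℕ) - (30 * m / d / 3 : ℕ) - (30 * m / d / 5 : ℕ) : ℝ) := by
    refine sum_nonneg fun d _ => mul_nonneg vonMangoldt_nonneg ?_
    have := chebyshev_coefficient_nonneg (30 * m / d)
    have : ((30 * m / d / 2 : ℕ) + (30 * m / d / 3 : ℕ) + (30 * m / d / 5 : ℕ) : ℝ) ≤
        (30 * m / d : ℕ) + (30 * m / d / 30 : ℕ) := mod_cast this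
    linarith
  have h₂ : ∑ d ∈ Ioc (5 * m) (30 * m), Λ d ≤
      ∑ d ∈ Ioc (5 * m) (30 * m), Λ d * ((30 * m / d : ℕ) + (30 * m / d / 30 : ℕ) -
      (30 * m / d / 2 : ℕ) - (30 * m / d / 3 : ℕ) - (30 * m / d / 5 : ℕ) : ℝ) := by
    refine sum_le_sum fun d hd => le_mul_of_one_le_right vonMangoldt_nonneg ?_
    rw [mem_Ioc] at hd
    have := one_le_chebyshev_coefficient (k := 30 * m / d) (Nat.div_pos hd.2 (by omega))
      ((Nat.div_lt_iff_lt_mul (by omega)).2 (by omega))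
    have : ((30 * m / d / 2 : ℕ) + (30 * m / d / 3 : ℕ) + (30 * m / d / 5 : ℕ) + 1 : ℝ) ≤
        (30 * m / d : ℕ) + (30 * m / d / 30 : ℕ) := mod_cast this
    linarith
  linarith

theorem log_factorial_le_stirling {n : ℕ} (hn : n ≠ 0) :
    Real.log n.factorial ≤ n * Real.log n - n + Real.log n / 2 + 1 := by
  obtain ⟨k, rfl⟩ := Nat.exists_eq_succ_of_ne_zero hn
  have h := Stirling.log_stirlingSeq'_antitone (Nat.zero_le k)
  simp only [Function.comp_apply, Nat.succ_eq_add_one, zero_add,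
    Stirling.log_stirlingSeq_formula] at h
  rw [Real.log_mul (by norm_num) (by positivity), Real.log_div (by positivity) (by positivity)] at h
  simp only [Real.log_exp] at h
  norm_num at h ⊢
  linarith

theorem log_natCast_mul {k m : ℕ} (hk : k ≠ 0) (hm : m ≠ 0) :
    Real.log ((k * m : ℕ) : ℝ) = Real.log k + Real.log m := by
  rw [Nat.cast_mul, Real.log_mul (by positivity) (by positivity)]

theorem log_six : Real.log 6 = Real.log 2 + Real.log 3 := by
  rw [← Real.log_mul (by norm_num) (by norm_num)]; norm_num

theorem log_ten : Real.log 10 = Real.log 2 + Real.log 5 := by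
  rw [← Real.log_mul (by norm_num) (by norm_num)]; norm_num

theorem log_fifteen : Real.log 15 = Real.log 3 + Real.log 5 := by
  rw [← Real.log_mul (by norm_num) (by norm_num)]; norm_num

theorem log_thirty : Real.log 30 = Real.log 2 + Real.log 3 + Real.log 5 := by
  rw [← Real.log_mul (by norm_num) (by norm_num), ← Real.log_mul (by norm_num) (by norm_num)]
  norm_num

theorem log_five_lt : Real.log 5 < 1.6174 := by
  have h : Real.log ((5 : ℝ) ^ 3) ≤ Real.log (2 ^ 7) := Real.log_le_log (by norm_num) (by norm_num)
  rw [Real.log_pow, Real.log_pow] at h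
  have := Real.log_two_lt_d9
  norm_num at h this ⊢
  linarith

theorem lt_log_five : 1.6059 < Real.log 5 := by
  have h : Real.log ((2 : ℝ) ^ 10 * 3) ≤ Real.log (5 ^ 5) :=
    Real.log_le_log (by norm_num) (by norm_num)
  rw [Real.log_mul (by norm_num) (by norm_num), Real.log_pow, Real.log_pow] at h
  have := Real.log_two_gt_d9
  have := Real.log_three_gt_d9
  norm_num at *
  linarith

theorem lt_log_two_pi_div_two : 0.89 < Real.log (2 * Real.pi) / 2 := by
  have h : Real.log 6.28 ≤ Real.log (2 * Real.pi) :=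
    Real.log_le_log (by norm_num) (by linarith [Real.pi_gt_d2])
  have h' : Real.log 6 ≤ Real.log 6.28 := Real.log_le_log (by norm_num) (by norm_num)
  have := Real.log_three_gt_d9
  have := Real.log_two_gt_d9
  rw [log_six] at h'
  norm_num at *
  linarith

theorem logFactorialRatio_le (m : ℕ) :
    logFactorialRatio m ≤ (14 * Real.log 2 + 9 * Real.log 3 + 5 * Real.log 5) * m := by
  rcases eq_or_ne m 0 with rfl | hm
  · simp [logFactorialRatio]
  have h₁ := log_factorial_le_stirling (n := 30 * m) (by omega)
  have h₂ := log_factorial_le_stirling hm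
  have h₃ := Stirling.le_log_factorial_stirling (n := 15 * m) (by omega)
  have h₄ := Stirling.le_log_factorial_stirling (n := 10 * m) (by omega)
  have h₅ := Stirling.le_log_factorial_stirling (n := 6 * m) (by omega)
  rw [log_natCast_mul (by norm_num) hm] at h₁ h₃ h₄ h₅
  push_cast at h₁ h₂ h₃ h₄ h₅
  rw [log_thirty] at h₁
  rw [log_fifteen] at h₃
  rw [log_ten] at h₄
  rw [log_six] at h₅
  have := lt_log_two_pi_div_two
  have := Real.log_two_gt_d9
  have : 0 ≤ Real.log m := Real.log_natCast_nonneg m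
  rw [logFactorialRatio]
  have := Real.log_three_gt_d9
  have := lt_log_five
  norm_num at *
  linarith

theorem le_logFactorialRatio {m : ℕ} (hm : m ≠ 0) :
    (14 * Real.log 2 + 9 * Real.log 3 + 5 * Real.log 5) * m - Real.log (30 * m) / 2 - 1.3 ≤
      logFactorialRatio m := by
  have h₁ := Stirling.le_log_factorial_stirling (n := 30 * m) (by omega)
  have h₂ := Stirling.le_log_factorial_stirling hm
  have h₃ := log_factorial_le_stirling (n := 15 * m) (by omega)
  have h₄ := log_factorial_le_stirling (n := 10 * m) (by omega)
  have h₅ := log_factorial_le_stirling (n := 6 * m) (by omega)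
  rw [log_natCast_mul (by norm_num) hm] at h₁ h₃ h₄ h₅
  push_cast at h₁ h₂ h₃ h₄ h₅
  rw [Real.log_mul (by norm_num) (by positivity), log_thirty]
  rw [log_thirty] at h₁
  rw [log_fifteen] at h₃
  rw [log_ten] at h₄
  rw [log_six] at h₅
  have := lt_log_two_pi_div_two
  rw [logFactorialRatio]
  norm_num at *
  linarith

/-- Checks `lcmUpto i ≤ 3 ^ i` for the `k` values `i = n, n + 1, …`, given `L = lcmUpto n`.
Matching on `n + 1` and `L + 1` makes the kernel reduce the accumulators to literals. -/
def lcmUptoLeThreePowCheck : ℕ → ℕ → ℕ → Bool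
  | 0, _, _ => true
  | k + 1, n + 1, L + 1 => decide (L + 1 ≤ 3 ^ (n + 1)) &&
      lcmUptoLeThreePowCheck k (n + 2) (Nat.lcm (L + 1) (n + 2))
  | _, _, _ => false

theorem lcmUpto_succ (n : ℕ) : Nat.lcmUpto (n + 1) = Nat.lcm (Nat.lcmUpto n) (n + 1) := by
  rw [Nat.lcmUpto, Nat.lcmUpto, ← insert_Icc_right_eq_Icc_add_one (by omega), lcm_insert]
  exact Nat.lcm_comm _ _

theorem lcmUpto_le_of_check {k n : ℕ} (h : lcmUptoLeThreePowCheck k n (Nat.lcmUpto n) = true)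
    {i : ℕ} (hi : i < k) : Nat.lcmUpto (n + i) ≤ 3 ^ (n + i) := by
  induction k generalizing n i with
  | zero => omega
  | succ k ih =>
    rcases n with _ | n
    · simp [lcmUptoLeThreePowCheck] at h
    obtain ⟨L, hL⟩ := Nat.exists_eq_succ_of_ne_zero (Nat.lcmUpto_ne_zero (n + 1))
    rw [hL, lcmUptoLeThreePowCheck, Bool.and_eq_true, decide_eq_true_eq,
      ← Nat.succ_eq_add_one L, ← hL, ← lcmUpto_succ (n + 1)] at h
    rcases i with _ | i
    · exact h.1
    · rw [show n + 1 + (i + 1) = n + 2 + i by ring]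
      exact ih h.2 (by omega)

/-- Checks `5 ^ i ≤ 2 ^ i * i#` for those of the `k` values `i = n, n + 1, …` with `599 ≤ i`,
given `P = n#`. -/
def primorialGeCheck : ℕ → ℕ → ℕ → Bool
  | 0, _, _ => true
  | k + 1, n + 1, P + 1 =>
      (decide (n + 1 < 599) || decide (5 ^ (n + 1) ≤ 2 ^ (n + 1) * (P + 1))) &&
      primorialGeCheck k (n + 2) (if Nat.Coprime (n + 2) (P + 1) then (n + 2) * (P + 1) else P + 1)
  | _, _, _ => false

theorem coprime_succ_primorial_iff {n : ℕ} (hn : n ≠ 0) :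
    Nat.Coprime (n + 1) (primorial n) ↔ (n + 1).Prime := by
  constructor
  · intro h
    by_contra hp
    have h2 : n + 1 ≠ 1 := by omega
    have hm := Nat.minFac_prime h2
    refine hm.one_lt.ne' (Nat.eq_one_of_dvd_coprimes h (Nat.minFac_dvd _) ?_)
    rw [hm.dvd_primorial_iff]
    have := (Nat.not_prime_iff_minFac_lt (by omega)).1 hp
    omega
  · intro hp
    rw [hp.coprime_iff_not_dvd, hp.dvd_primorial_iff]
    omega

theorem primorial_succ_eq_ite {n : ℕ} (hn : n ≠ 0) : primorial (n + 1) =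
    if Nat.Coprime (n + 1) (primorial n) then (n + 1) * primorial n else primorial n := by
  simp only [coprime_succ_primorial_iff hn]
  rw [primorial, range_add_one, filter_insert]
  split_ifs with h
  · rw [prod_insert (by simp)]; rfl
  · rfl

theorem primorial_ge_of_check {k n : ℕ} (h : primorialGeCheck k n (primorial n) = true)
    {i : ℕ} (hi : i < k) (hn : 599 ≤ n + i) : 5 ^ (n + i) ≤ 2 ^ (n + i) * primorial (n + i) := by
  induction k generalizing n i with
  | zero => omega
  | succ k ih =>
    rcases n with _ | n
    · simp [primorialGeCheck] at h
    obtain ⟨L, hL⟩ := Nat.exists_eq_succ_of_ne_zero (primorial_ne_zero (n + 1))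
    rw [hL, primorialGeCheck, Bool.and_eq_true, Bool.or_eq_true, decide_eq_true_eq,
      decide_eq_true_eq, ← Nat.succ_eq_add_one L, ← hL, ← primorial_succ_eq_ite (by omega)] at h
    rcases i with _ | i
    · exact h.1.resolve_left (by omega)
    · rw [show n + 1 + (i + 1) = n + 2 + i by ring] at hn ⊢
      exact ih h.2 (by omega) hn

theorem lcmUpto_le_three_pow {n : ℕ} (hn : n ≤ 1200) : Nat.lcmUpto n ≤ 3 ^ n := by
  rcases n with _ | n
  · simp [Nat.lcmUpto]
  have h : lcmUptoLeThreePowCheck 1200 1 1 = true := by decide +kernel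
  rw [add_comm]
  exact lcmUpto_le_of_check (by simpa [Nat.lcmUpto] using h) (by omega)

theorem five_pow_le_two_pow_mul_primorial {n : ℕ} (h : 599 ≤ n) (hn : n ≤ 2025) :
    5 ^ n ≤ 2 ^ n * primorial n := by
  have hc : primorialGeCheck 2025 1 1 = true := by decide +kernel
  obtain ⟨i, rfl⟩ := Nat.exists_eq_add_of_le (show 1 ≤ n by omega)
  exact primorial_ge_of_check (by simpa using hc) (by omega) h

theorem psi_natCast_le (n : ℕ) : ψ n ≤ 1.1427 * n := by
  induction n using Nat.strong_induction_on with
  | _ n ih =>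
    rcases le_or_gt n 1200 with hn | hn
    · rw [psi_eq_log_lcmUpto]
      have h : (Nat.lcmUpto n : ℝ) ≤ 3 ^ n := mod_cast lcmUpto_le_three_pow hn
      have h := Real.log_le_log (by exact_mod_cast Nat.lcmUpto_pos n) h
      rw [Real.log_pow] at h
      have := Real.log_three_lt_d9
      have : (0 : ℝ) ≤ n := n.cast_nonneg
      norm_num at *
      nlinarith
    · obtain ⟨m, hm, hm'⟩ : ∃ m, n ≤ 30 * m ∧ 30 * m ≤ n + 29 :=
        ⟨(n + 29) / 30, by omega, by omega⟩
      have h₁ := ih (5 * m) (by omega)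
      have h₂ := psi_sub_psi_le_logFactorialRatio m
      have h₃ := logFactorialRatio_le m
      have h₄ : ψ n ≤ ψ (30 * m : ℕ) := psi_mono (by exact_mod_cast hm)
      have h₅ : (30 * m : ℝ) ≤ n + 29 := mod_cast hm'
      have h₆ : (40 : ℝ) ≤ m := by exact_mod_cast (by omega : 40 ≤ m)
      have h₇ : (14 * Real.log 2 + 9 * Real.log 3 + 5 * Real.log 5) * m ≤ 27.68 * m := by
        have := Real.log_two_lt_d9
        have := Real.log_three_lt_d9
        have := log_five_lt
        gcongr
        norm_num at *
        linarith
      push_cast at h₁ h₂ h₄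
      norm_num at h₁ h₇ ⊢
      linarith

theorem psi_le_mul_self {x : ℝ} (hx : 0 ≤ x) : ψ x ≤ 1.1427 * x := by
  rw [psi_eq_psi_coe_floor]
  grw [psi_natCast_le, Nat.floor_le hx]

theorem mul_lt_theta_of_le {n : ℕ} (hn : 2025 ≤ n) : 0.8573 * n < θ n := by
  have hn' : (2025 : ℝ) ≤ n := mod_cast hn
  have hn0 : (0 : ℝ) < n := by linarith
  obtain ⟨m, hm, hm'⟩ : ∃ m, 30 * m ≤ n ∧ n ≤ 30 * m + 29 := ⟨n / 30, by omega, by omega⟩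
  have hmn : (30 * m : ℝ) ≤ n := mod_cast hm
  have hmn' : (n : ℝ) ≤ 30 * m + 29 := mod_cast hm'
  have hm0 : (0 : ℝ) < m := by exact_mod_cast (by omega : 0 < m)
  have h₁ := logFactorialRatio_le_psi m
  have h₂ := le_logFactorialRatio (m := m) (by omega)
  have h₃ : ψ (30 * m : ℕ) ≤ ψ n := psi_mono (by exact_mod_cast hm)
  have h₄ : 27.62 * m ≤ (14 * Real.log 2 + 9 * Real.log 3 + 5 * Real.log 5) * m := by
    have := Real.log_two_gt_d9
    have := Real.log_three_gt_d9
    have := lt_log_five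
    gcongr
    norm_num at *
    linarith
  have h₅ := psi_sub_theta_le_psi_add_psi_add_psi n
  set s : ℝ := (n : ℝ) ^ (2 : ℝ)⁻¹ with hs
  have hs0 : 0 < s := by positivity
  have hs2 : s ^ 2 = n := by
    rw [hs, ← Real.rpow_natCast, ← Real.rpow_mul hn0.le]; norm_num
  have hs45 : 45 ≤ s := by nlinarith
  have hcube : (n : ℝ) ^ (3 : ℝ)⁻¹ ≤ s / 3 := by
    refine le_of_pow_le_pow_left₀ (n := 3) (by norm_num) (by positivity) ?_
    rw [← Real.rpow_natCast, ← Real.rpow_mul hn0.le]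
    norm_num
    nlinarith
  have hfifth : (n : ℝ) ^ (5 : ℝ)⁻¹ ≤ s / 3 :=
    (Real.rpow_le_rpow_of_exponent_le (by linarith) (by norm_num)).trans hcube
  have h₆ : ψ s ≤ 1.1427 * s := psi_le_mul_self hs0.le
  have h₇ : ψ ((n : ℝ) ^ (3 : ℝ)⁻¹) ≤ 1.1427 * (s / 3) :=
    (psi_mono hcube).trans (psi_le_mul_self (by positivity))
  have h₈ : ψ ((n : ℝ) ^ (5 : ℝ)⁻¹) ≤ 1.1427 * (s / 3) :=
    (psi_mono hfifth).trans (psi_le_mul_self (by positivity))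
  have hlog : Real.log (30 * m) / 2 ≤ s / 40 + 3 := by
    have h : Real.log (30 * m) ≤ Real.log (s ^ 2) := Real.log_le_log (by positivity) (by linarith)
    have h' : Real.log s = Real.log (s / 40) + Real.log 40 := by
      rw [← Real.log_mul (by positivity) (by norm_num)]; congr 1; ring
    have h'' := Real.log_le_sub_one_of_pos (show 0 < s / 40 by positivity)
    have h40 : Real.log 40 ≤ 4 := by
      have : Real.log 40 ≤ Real.log (2 ^ 3 * 5) := by norm_num
      rw [Real.log_mul (by norm_num) (by norm_num), Real.log_pow] at this
      have := Real.log_two_lt_d9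
      have := log_five_lt
      norm_num at *
      linarith
    rw [Real.log_pow] at h
    push_cast at h
    linarith
  norm_num at *
  nlinarith

theorem mul_lt_theta {n : ℕ} (hn : 599 ≤ n) : 0.8573 * n < θ n := by
  rcases le_or_gt n 2025 with h | h
  · have hp : (5 : ℝ) ^ n ≤ 2 ^ n * primorial n := mod_cast five_pow_le_two_pow_mul_primorial hn h
    replace hp := Real.log_le_log (by positivity) hp
    have h0 : (0 : ℝ) < primorial n := mod_cast primorial_pos n
    rw [Real.log_mul (by positivity) (by positivity), Real.log_pow, Real.log_pow] at hp
    rw [theta_eq_log_primorial, Nat.floor_natCast]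
    have := Real.log_two_lt_d9
    have := lt_log_five
    have hn0 : (0 : ℝ) < n := by exact_mod_cast (by omega : 0 < n)
    have hlog : 0.8573 < Real.log 5 - Real.log 2 := by
      norm_num at *
      linarith
    nlinarith [mul_lt_mul_of_pos_right hlog hn0]
  · exact mul_lt_theta_of_le h.le

theorem log_theta_upper_const_lt : Real.log 1.1427 < 0.1334 := by
  rw [Real.log_lt_iff_lt_exp (by norm_num)]
  refine lt_of_lt_of_le ?_ (Real.sum_le_exp_of_nonneg (by norm_num) 5)
  norm_num [sum_range_succ, Nat.factorial]

theorem lt_log_theta_lower_const : -0.15398 < Real.log 0.8573 := by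
  rw [Real.lt_log_iff_exp_lt (by norm_num), Real.exp_neg]
  rw [inv_lt_comm₀ (Real.exp_pos _) (by norm_num)]
  refine lt_of_lt_of_le ?_ (Real.sum_le_exp_of_nonneg (by norm_num) 6)
  norm_num [sum_range_succ, Nat.factorial]

theorem primorial'_eq_primorial_nthPrime {n : ℕ} (hn : n ≠ 0) :
    primorial' n = primorial (nthPrime n) := by
  rw [primorial', primorial, nthPrime]
  have himage : (range (Nat.nth Nat.Prime (n - 1) + 1)).filter Nat.Prime =
      (range n).image (Nat.nth Nat.Prime) := by
    ext q
    simp only [mem_filter, mem_range, mem_image, Nat.lt_succ_iff]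
    constructor
    · rintro ⟨hq, hp⟩
      refine ⟨Nat.count Nat.Prime q, ?_, Nat.nth_count hp⟩
      rw [← Nat.nth_count hp, (Nat.nth_strictMono Nat.infinite_setOfPred_prime).le_iff_le] at hq
      omega
    · rintro ⟨i, hi, rfl⟩
      exact ⟨(Nat.nth_strictMono Nat.infinite_setOfPred_prime).monotone (by omega),
        Nat.prime_nth_prime i⟩
  rw [himage, prod_image (Nat.nth_injective Nat.infinite_setOfPred_prime).injOn]

theorem log_primorial'_eq_theta {n : ℕ} (hn : n ≠ 0) :
    Real.log (primorial' n) = θ (nthPrime n) := by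
  rw [primorial'_eq_primorial_nthPrime hn, theta_eq_log_primorial, Nat.floor_natCast]

end

/-- If `pₙ ≥ 599`, then `log log(pₙ#) − 0.1334 < log pₙ < log log(pₙ#) + 0.15398`. -/
theorem statement14 (n : ℕ) (hn : 599 ≤ nthPrime n) :
    Real.log (Real.log (primorial' n)) - 0.1334 < Real.log (nthPrime n) ∧
      Real.log (nthPrime n) < Real.log (Real.log (primorial' n)) + 0.15398 := by
  have hn0 : n ≠ 0 := by
    rintro rfl
    simp [nthPrime] at hn
  rw [log_primorial'_eq_theta hn0]
  have hp : (0 : ℝ) < nthPrime n := by exact_mod_cast (by omega : 0 < nthPrime n)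
  have hlower := mul_lt_theta hn
  have hupper := (Chebyshev.theta_le_psi _).trans (psi_natCast_le (nthPrime n))
  have hlower_log := Real.log_lt_log (by positivity) hlower
  have hupper_log := Real.log_le_log (lt_trans (by positivity) hlower) hupper
  rw [Real.log_mul (by norm_num) hp.ne'] at hlower_log hupper_log
  constructor <;> linarith [log_theta_upper_const_lt, lt_log_theta_lower_const]
end

section
/- There exists a constant C > 0 such that for every real x ≥ 3, π₂(x) ≤ C · x (log log x)² / (log x)². (Brun's theorem: π₂(x) = O(x (log log x)² / log² x).) -/
open Finset

/-- `primePi2 x` is π₂(x), the number of primes `p ≤ x` with `p + 2` also prime. -/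
noncomputable def primePi2 (x : ℝ) : ℕ :=
  ((Finset.range (Nat.floor x + 1)).filter
    (fun p : ℕ => p.Prime ∧ (p + 2).Prime ∧ (p : ℝ) ≤ x)).card

theorem ite_eq_empty_le_sum_powerset_card_le {α : Type*} [DecidableEq α] (A : Finset α) {m : ℕ}
    (hm : Even m) :
    (if A = ∅ then (1 : ℝ) else 0) ≤ ∑ T ∈ A.powerset with #T ≤ m, (-1 : ℝ) ^ #T := by
  have key : ∑ T ∈ A.powerset with #T ≤ m, (-1 : ℝ) ^ #T
      = ((∑ k ∈ range (m + 1), (-1) ^ k * (#A).choose k : ℤ) : ℝ) := by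
    have hmaps : ∀ T ∈ A.powerset.filter (#· ≤ m), #T ∈ range (m + 1) := by
      intro T hT
      simp only [mem_filter] at hT
      simpa [Nat.lt_succ_iff] using hT.2
    rw [← sum_fiberwise_of_maps_to hmaps]
    push_cast
    refine sum_congr rfl fun k hk => ?_
    have : ((A.powerset.filter (#· ≤ m)).filter (#· = k)) = A.powersetCard k := by
      ext T
      simp only [mem_filter, mem_powerset, mem_powersetCard, mem_range] at hk ⊢
      constructor
      · rintro ⟨⟨h1, -⟩, h2⟩
        exact ⟨h1, h2⟩
      · rintro ⟨h1, h2⟩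
        exact ⟨⟨h1, by omega⟩, h2⟩
    rw [this, sum_congr rfl fun T hT => by rw [(mem_powersetCard.1 hT).2], sum_const,
      card_powersetCard, nsmul_eq_mul, mul_comm]
  rw [key]
  rcases A.eq_empty_or_nonempty with rfl | hA
  · have : ∑ k ∈ range (m + 1), ((-1) ^ k * (0 : ℕ).choose k : ℤ) = 1 := by
      rw [sum_range_succ']
      simp
    rw [card_empty, this]
    simp
  · obtain ⟨n, hn⟩ := Nat.exists_eq_succ_of_ne_zero hA.card_pos.ne'
    rw [if_neg hA.ne_empty, hn, Nat.succ_eq_add_one, Int.alternating_sum_range_choose_eq_choose,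
      hm.neg_one_pow, one_mul]
    positivity

theorem abs_card_filter_modEq_sub_le (N a : ℕ) {q : ℕ} (hq : q ≠ 0) :
    |(#{n ∈ range N | n ≡ a [MOD q]} : ℝ) - N / q| ≤ 1 := by
  have hq0 : 0 < q := Nat.pos_of_ne_zero hq
  have h1 : #{n ∈ range N | n ≡ a [MOD q]} = N / q + if a % q < N % q then 1 else 0 := by
    rw [← Nat.count_modEq_card _ hq0, Nat.count_eq_card_filter_range]
  have h2 : ((N / q : ℕ) : ℝ) ≤ N / q := Nat.cast_div_le
  have h3 : (N : ℝ) / q < (N / q : ℕ) + 1 := by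
    rw [div_lt_iff₀ (by positivity)]
    exact_mod_cast Nat.lt_mul_of_div_lt (Nat.lt_succ_self _) hq0
  rw [h1, abs_le]
  split_ifs with h
  · push_cast; constructor <;> linarith
  · push_cast; constructor <;> linarith

theorem abs_card_filter_modEq_and_dvd_sub_le (N : ℕ) (T : Finset ℕ) :
    (∀ p ∈ T, p.Prime ∧ p ≠ 2) → ∀ q a : ℕ, q ≠ 0 → (∀ p ∈ T, q.Coprime p) →
    |(#{n ∈ range N | n ≡ a [MOD q] ∧ ∀ p ∈ T, p ∣ n * (n + 2)} : ℝ)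
      - N / q * ∏ p ∈ T, (2 / p : ℝ)| ≤ 2 ^ #T := by
  induction T using Finset.induction_on with
  | empty =>
    intro _ q a hq _
    simpa using abs_card_filter_modEq_sub_le N a hq
  | insert p T hpT ih =>
    intro hT q a hq hqT
    obtain ⟨hp, hp2⟩ := hT p (mem_insert_self _ _)
    have hT' : ∀ r ∈ T, r.Prime ∧ r ≠ 2 := fun r hr => hT r (mem_insert_of_mem hr)
    have hqp : q.Coprime p := hqT p (mem_insert_self _ _)
    have hcop : ∀ r ∈ T, (q * p).Coprime r := fun r hr =>
      Nat.Coprime.mul_left (hqT r (mem_insert_of_mem hr))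
        ((Nat.coprime_primes hp (hT' r hr).1).2 fun h => hpT (h ▸ hr))
    obtain ⟨b, hb1, hb2⟩ := Nat.chineseRemainder hqp a 0
    obtain ⟨c, hc1, hc2⟩ := Nat.chineseRemainder hqp a (p - 2)
    have hp3 : 2 < p := lt_of_le_of_ne hp.two_le hp2.symm
    have hqp0 : q * p ≠ 0 := mul_ne_zero hq hp.ne_zero
    have hmod0 : ∀ n, n ≡ 0 [MOD p] ↔ p ∣ n := fun n => Nat.modEq_zero_iff_dvd
    have hmod2 : ∀ n, n ≡ p - 2 [MOD p] ↔ p ∣ n + 2 := fun n => by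
      rw [← Nat.modEq_zero_iff_dvd]
      constructor
      · intro h
        have := h.add_right 2
        rw [Nat.sub_add_cancel hp3.le] at this
        exact this.trans (by simp [Nat.ModEq])
      · intro h
        refine Nat.ModEq.add_right_cancel' 2 ?_
        rw [Nat.sub_add_cancel hp3.le]
        exact h.trans (by simp [Nat.ModEq])
    have hcrt : ∀ n d e : ℕ, d ≡ a [MOD q] → d ≡ e [MOD p] →
        (n ≡ d [MOD q * p] ↔ n ≡ a [MOD q] ∧ n ≡ e [MOD p]) := fun n d e h1 h2 => by
      rw [← Nat.modEq_and_modEq_iff_modEq_mul hqp]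
      exact and_congr ⟨fun h => h.trans h1, fun h => h.trans h1.symm⟩
        ⟨fun h => h.trans h2, fun h => h.trans h2.symm⟩
    have hsplit : {n ∈ range N | n ≡ a [MOD q] ∧ ∀ r ∈ insert p T, r ∣ n * (n + 2)}
        = {n ∈ range N | n ≡ b [MOD q * p] ∧ ∀ r ∈ T, r ∣ n * (n + 2)} ∪
          {n ∈ range N | n ≡ c [MOD q * p] ∧ ∀ r ∈ T, r ∣ n * (n + 2)} := by
      ext n
      simp only [mem_filter, mem_union, hcrt n b 0 hb1 hb2, hcrt n c (p - 2) hc1 hc2, hmod0, hmod2,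
        forall_mem_insert, hp.dvd_mul]
      tauto
    have hdisj : Disjoint {n ∈ range N | n ≡ b [MOD q * p] ∧ ∀ r ∈ T, r ∣ n * (n + 2)}
          {n ∈ range N | n ≡ c [MOD q * p] ∧ ∀ r ∈ T, r ∣ n * (n + 2)} := by
      rw [disjoint_filter]
      rintro n - ⟨h1, -⟩ ⟨h2, -⟩
      have h3 := (hmod0 n).1 ((hcrt n b 0 hb1 hb2).1 h1).2
      have h4 := (hmod2 n).1 ((hcrt n c (p - 2) hc1 hc2).1 h2).2
      exact absurd (Nat.le_of_dvd two_pos ((Nat.dvd_add_right h3).1 h4)) (by omega)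
    rw [hsplit, card_union_of_disjoint hdisj, prod_insert hpT, card_insert_of_notMem hpT]
    have hb := ih hT' (q * p) b hqp0 hcop
    have hc := ih hT' (q * p) c hqp0 hcop
    have hpR : (p : ℝ) ≠ 0 := by exact_mod_cast hp.ne_zero
    have hqR : (q : ℝ) ≠ 0 := by exact_mod_cast hq
    have e : (N : ℝ) / q * (2 / p * ∏ p ∈ T, (2 / p : ℝ))
        = 2 * (N / (q * p : ℕ) * ∏ p ∈ T, (2 / p : ℝ)) := by
      push_cast; field_simp
    rw [e, pow_succ]
    rw [abs_le] at hb hc ⊢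
    push_cast at hb hc ⊢
    constructor <;> linarith [hb.1, hb.2, hc.1, hc.2]

/-- The number of `n < N` such that each prime in `T` divides `n * (n + 2)` is `N * ∏ p ∈ T, 2 / p` up to `2 ^ #T`. -/
theorem abs_card_filter_dvd_sub_le (N : ℕ) {T : Finset ℕ} (hT : ∀ p ∈ T, p.Prime ∧ p ≠ 2) :
    |(#{n ∈ range N | ∀ p ∈ T, p ∣ n * (n + 2)} : ℝ) - N * ∏ p ∈ T, (2 / p : ℝ)| ≤ 2 ^ #T := by
  simpa [Nat.modEq_one] using
    abs_card_filter_modEq_and_dvd_sub_le N T hT 1 0 one_ne_zero (by simp)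

theorem card_sifted_le_sum (N : ℕ) {P : Finset ℕ} (hP : ∀ p ∈ P, p.Prime ∧ p ≠ 2) {m : ℕ}
    (hm : Even m) :
    (#{n ∈ range N | ∀ p ∈ P, ¬ p ∣ n * (n + 2)} : ℝ) ≤
      N * (∏ p ∈ P, (1 - 2 / p : ℝ) + ∑ T ∈ P.powerset with m < #T, ∏ p ∈ T, (2 / p : ℝ))
        + ∑ T ∈ P.powerset with #T ≤ m, (2 : ℝ) ^ #T := by
  set A : ℕ → Finset ℕ := fun n => {p ∈ P | p ∣ n * (n + 2)} with hA
  have h1 : (#{n ∈ range N | ∀ p ∈ P, ¬ p ∣ n * (n + 2)} : ℝ)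
      = ∑ n ∈ range N, if A n = ∅ then (1 : ℝ) else 0 := by
    rw [sum_boole]
    simp [hA, filter_eq_empty_iff]
  have h2 : ∑ n ∈ range N, ∑ T ∈ (A n).powerset with #T ≤ m, (-1 : ℝ) ^ #T
      = ∑ T ∈ P.powerset with #T ≤ m,
          (-1 : ℝ) ^ #T * #{n ∈ range N | ∀ p ∈ T, p ∣ n * (n + 2)} := by
    rw [sum_comm' (t' := P.powerset.filter (#· ≤ m))
      (s' := fun T => {n ∈ range N | ∀ p ∈ T, p ∣ n * (n + 2)})]
    · refine sum_congr rfl fun T _ => ?_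
      rw [sum_const, nsmul_eq_mul, mul_comm]
    · intro n T
      simp only [hA, mem_range, mem_filter, mem_powerset, subset_iff]
      grind
  have h3 : ∀ T ∈ P.powerset.filter (#· ≤ m),
      (-1 : ℝ) ^ #T * #{n ∈ range N | ∀ p ∈ T, p ∣ n * (n + 2)}
        ≤ N * ∏ p ∈ T, (-(2 / p) : ℝ) + 2 ^ #T := by
    intro T hT
    simp only [mem_filter, mem_powerset] at hT
    have := abs_card_filter_dvd_sub_le N fun p hp => hP p (hT.1 hp)
    rw [prod_neg]
    have h := (le_abs_self _).trans_eq (abs_mul ((-1 : ℝ) ^ #T)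
      ((#{n ∈ range N | ∀ p ∈ T, p ∣ n * (n + 2)} : ℝ) - N * ∏ p ∈ T, (2 / p : ℝ)))
    rw [abs_neg_one_pow, one_mul] at h
    linarith
  have h4 : ∑ T ∈ P.powerset with #T ≤ m, ∏ p ∈ T, (-(2 / p) : ℝ) ≤
      ∏ p ∈ P, (1 - 2 / p : ℝ) + ∑ T ∈ P.powerset with m < #T, ∏ p ∈ T, (2 / p : ℝ) := by
    have h5 : ∏ p ∈ P, (1 - 2 / p : ℝ) = ∑ T ∈ P.powerset, ∏ p ∈ T, (-(2 / p) : ℝ) := by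
      rw [← prod_one_add]; rfl
    rw [h5, ← sum_filter_add_sum_filter_not P.powerset (#· ≤ m), add_assoc]
    simp only [not_le]
    rw [← sum_add_distrib]
    refine le_add_of_nonneg_right (sum_nonneg fun T _ => ?_)
    rw [prod_neg]
    have hpos : (0 : ℝ) ≤ ∏ p ∈ T, (2 / p : ℝ) := prod_nonneg fun p _ => by positivity
    rcases neg_one_pow_eq_or ℝ #T with h | h <;> rw [h] <;> linarith
  calc _ = _ := h1
    _ ≤ _ := sum_le_sum fun n _ => ite_eq_empty_le_sum_powerset_card_le (A n) hm
    _ = _ := h2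
    _ ≤ _ := sum_le_sum h3
    _ = N * ∑ T ∈ P.powerset with #T ≤ m, ∏ p ∈ T, (-(2 / p) : ℝ)
        + ∑ T ∈ P.powerset with #T ≤ m, (2 : ℝ) ^ #T := by
      rw [sum_add_distrib, mul_sum]
    _ ≤ _ := by gcongr

theorem sum_powerset_card_le_two_pow_le {α : Type*} (P : Finset α) (m : ℕ) {z : ℝ} (hz : 1 ≤ z)
    (hP : #P ≤ z) :
    ∑ T ∈ P.powerset with #T ≤ m, (2 : ℝ) ^ #T ≤ Real.exp 2 * z ^ m := by
  have hz0 : 0 < z := by linarith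
  calc ∑ T ∈ P.powerset with #T ≤ m, (2 : ℝ) ^ #T
      ≤ ∑ T ∈ P.powerset with #T ≤ m, z ^ m * ∏ _p ∈ T, (2 / z) := by
        refine sum_le_sum fun T hT => ?_
        rw [prod_const, div_pow, mul_div_assoc', le_div_iff₀ (by positivity), mul_comm]
        gcongr
        exact (mem_filter.1 hT).2
    _ ≤ ∑ T ∈ P.powerset, z ^ m * ∏ _p ∈ T, (2 / z) :=
        sum_le_sum_of_subset_of_nonneg (filter_subset _ _) fun T _ _ =>
          mul_nonneg (by positivity) (prod_nonneg fun _ _ => by positivity)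
    _ = z ^ m * (1 + 2 / z) ^ #P := by rw [← mul_sum, ← prod_one_add, prod_const]
    _ ≤ z ^ m * Real.exp 2 := by
        gcongr
        calc (1 + 2 / z) ^ #P ≤ Real.exp (2 / z) ^ #P := by
              gcongr
              linarith [Real.add_one_le_exp (2 / z)]
          _ = Real.exp (#P * (2 / z)) := (Real.exp_nat_mul _ _).symm
          _ ≤ Real.exp 2 := by
              gcongr
              rw [mul_div_assoc', div_le_iff₀ hz0]
              nlinarith
    _ = _ := mul_comm _ _

theorem sum_powerset_lt_card_prod_le {α : Type*} (P : Finset α) (m : ℕ) {f : α → ℝ}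
    (hf : ∀ p, 0 ≤ f p) :
    ∑ T ∈ P.powerset with m < #T, ∏ p ∈ T, f p ≤ Real.exp (3 * ∑ p ∈ P, f p - m) := by
  have he : Real.exp 1 ≤ 3 := by linarith [Real.exp_one_lt_d9]
  calc ∑ T ∈ P.powerset with m < #T, ∏ p ∈ T, f p
      ≤ ∑ T ∈ P.powerset with m < #T, Real.exp (-m) * ∏ p ∈ T, 3 * f p := by
        refine sum_le_sum fun T hT => ?_
        rw [prod_mul_distrib, prod_const, ← mul_assoc]
        refine le_mul_of_one_le_left (prod_nonneg fun p _ => hf p) ?_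
        calc (1 : ℝ) = Real.exp (-m) * Real.exp 1 ^ m := by
              rw [← Real.exp_nat_mul, ← Real.exp_add]; simp
          _ ≤ Real.exp (-m) * Real.exp 1 ^ #T := by
              gcongr
              · exact Real.one_le_exp zero_le_one
              · exact (mem_filter.1 hT).2.le
          _ ≤ _ := by gcongr
    _ ≤ ∑ T ∈ P.powerset, Real.exp (-m) * ∏ p ∈ T, 3 * f p :=
        sum_le_sum_of_subset_of_nonneg (filter_subset _ _) fun T _ _ =>
          mul_nonneg (by positivity) (prod_nonneg fun p _ => by linarith [hf p])
    _ = Real.exp (-m) * ∏ p ∈ P, (1 + 3 * f p) := by rw [← mul_sum, ← prod_one_add]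
    _ ≤ Real.exp (-m) * ∏ p ∈ P, Real.exp (3 * f p) := by
        gcongr with p
        · intro p _; linarith [hf p]
        · linarith [Real.add_one_le_exp (3 * f p)]
    _ = _ := by
        rw [← Real.exp_sum, ← mul_sum, ← Real.exp_add]; ring_nf

theorem sum_primesBelow_two_pow_inv_le (J : ℕ) :
    ∑ p ∈ Nat.primesBelow (2 ^ (J + 1)), (p : ℝ)⁻¹ ≤ 4 * harmonic J := by
  induction J with
  | zero => simp
  | succ j ih =>
    have hsub : Nat.primesBelow (2 ^ (j + 1)) ⊆ Nat.primesBelow (2 ^ (j + 1 + 1)) :=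
      Nat.primesBelow_mono (Nat.pow_le_pow_right two_pos (by omega))
    rw [← sum_sdiff hsub, harmonic_succ]
    push_cast
    have hlog2 : 0 < Real.log 2 := Real.log_pos one_lt_two
    have h1 : ∀ p ∈ Nat.primesBelow (2 ^ (j + 1 + 1)) \ Nat.primesBelow (2 ^ (j + 1)),
        (p : ℝ)⁻¹ ≤ (2 ^ (j + 1) * ((j + 1) * Real.log 2))⁻¹ * Real.log p := by
      intro p hp
      simp only [mem_sdiff, Nat.mem_primesBelow, not_and] at hp
      have hpj : 2 ^ (j + 1) ≤ p := by
        by_contra h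
        exact hp.2 (by omega) hp.1.2
      have hpR : (2 : ℝ) ^ (j + 1) ≤ p := by exact_mod_cast hpj
      have hl : (j + 1) * Real.log 2 ≤ Real.log p := by
        have := Real.log_le_log (by positivity) hpR
        rw [Real.log_pow] at this
        exact_mod_cast this
      have hp0 : (0 : ℝ) < p := lt_of_lt_of_le (by positivity) hpR
      rw [inv_mul_eq_div, le_div_iff₀ (by positivity), inv_mul_le_iff₀ hp0]
      gcongr
    have h2 : ∑ p ∈ Nat.primesBelow (2 ^ (j + 1 + 1)) \ Nat.primesBelow (2 ^ (j + 1)), Real.log p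
        ≤ 2 * Real.log 2 * 2 ^ (j + 1 + 1) := by
      calc _ ≤ ∑ p ∈ Nat.primesLE (2 ^ (j + 1 + 1)), Real.log p := by
            refine sum_le_sum_of_subset_of_nonneg ?_ fun p _ _ => Real.log_natCast_nonneg p
            intro p hp
            simp only [mem_sdiff, Nat.mem_primesBelow] at hp
            exact Nat.mem_primesLE.2 ⟨hp.1.1.le, hp.1.2⟩
        _ = Chebyshev.theta (2 ^ (j + 1 + 1) : ℕ) := (Chebyshev.theta_eq_sum_primesLE_log _).symm
        _ ≤ Real.log 4 * (2 ^ (j + 1 + 1) : ℕ) := Chebyshev.theta_le_log4_mul_x (by positivity)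
        _ = _ := by
            rw [show (4 : ℝ) = 2 ^ 2 by norm_num, Real.log_pow]
            push_cast
            ring
    have h3 := sum_le_sum h1
    rw [← mul_sum] at h3
    have h4 : (2 ^ (j + 1) * (((j : ℝ) + 1) * Real.log 2))⁻¹ * (2 * Real.log 2 * 2 ^ (j + 1 + 1))
        = 4 * ((j : ℝ) + 1)⁻¹ := by
      field_simp
      ring
    have h5 := mul_le_mul_of_nonneg_left h2
      (show (0 : ℝ) ≤ (2 ^ (j + 1) * (((j : ℝ) + 1) * Real.log 2))⁻¹ by positivity)
    linarith

theorem log_le_prod_primesBelow_inv (n : ℕ) :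
    Real.log n ≤ ∏ p ∈ n.primesBelow, (1 - (p : ℝ)⁻¹)⁻¹ := by
  rcases n with _ | n
  · simp
  let f : ℕ →* ℝ := ⟨⟨fun k => (k : ℝ)⁻¹, by simp⟩, fun a b => by simp [mul_comm]⟩
  have hf : ∀ {p : ℕ}, p.Prime → ‖f p‖ < 1 := fun {p} hp => by
    change ‖(p : ℝ)⁻¹‖ < 1
    rw [norm_inv, RCLike.norm_natCast]
    exact inv_lt_one_of_one_lt₀ (by exact_mod_cast hp.one_lt)
  obtain ⟨hs, hsum⟩ :=
    EulerProduct.summable_and_hasSum_smoothNumbers_prod_primesBelow_geometric hf (n + 1)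
  have hsmooth : ∀ k ∈ Icc 1 n, k ∈ (n + 1).smoothNumbers := fun k hk => by
    rw [mem_Icc] at hk
    exact Nat.mem_smoothNumbers_of_lt (by omega) (by omega)
  calc Real.log (n + 1 : ℕ) ≤ harmonic n := log_add_one_le_harmonic n
    _ = ∑ k ∈ Icc 1 n, f k := by
        rw [harmonic_eq_sum_Icc]; push_cast; rfl
    _ = ∑ k ∈ (Icc 1 n).subtype (· ∈ (n + 1).smoothNumbers), f k :=
        (sum_subtype_of_mem _ hsmooth).symm
    _ ≤ _ := sum_le_hasSum _ (fun k _ => by change (0 : ℝ) ≤ ((k : ℕ) : ℝ)⁻¹; positivity) hsum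

theorem prod_primesBelow_erase_two_le {z : ℕ} (hz : 2 < z) :
    ∏ p ∈ z.primesBelow.erase 2, (1 - 2 / p : ℝ) ≤ 4 / Real.log z ^ 2 := by
  have h2 : 2 ∈ z.primesBelow := Nat.mem_primesBelow.2 ⟨hz, Nat.prime_two⟩
  have hlog : 0 < Real.log z := Real.log_pos (by exact_mod_cast (by omega : 1 < z))
  have hpos : ∀ p ∈ z.primesBelow, 0 < 1 - (p : ℝ)⁻¹ := fun p hp => by
    have : (1 : ℝ) < p := by exact_mod_cast (Nat.prime_of_mem_primesBelow hp).one_lt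
    linarith [inv_lt_one_of_one_lt₀ this]
  have hM : ∏ p ∈ z.primesBelow, (1 - (p : ℝ)⁻¹) ≤ (Real.log z)⁻¹ := by
    rw [le_inv_comm₀ (prod_pos hpos) hlog, ← prod_inv_distrib]
    exact log_le_prod_primesBelow_inv z
  have hE : ∏ p ∈ z.primesBelow.erase 2, (1 - (p : ℝ)⁻¹)
      = 2 * ∏ p ∈ z.primesBelow, (1 - (p : ℝ)⁻¹) := by
    rw [← mul_prod_erase _ _ h2]
    norm_num
    ring
  calc ∏ p ∈ z.primesBelow.erase 2, (1 - 2 / p : ℝ)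
      ≤ ∏ p ∈ z.primesBelow.erase 2, (1 - (p : ℝ)⁻¹) ^ 2 := by
        refine prod_le_prod (fun p hp => ?_) fun p _ => ?_
        · have : (2 : ℝ) ≤ p := by
            exact_mod_cast (Nat.prime_of_mem_primesBelow (mem_of_mem_erase hp)).two_le
          rw [sub_nonneg]
          exact div_le_one_of_le₀ this (by positivity)
        · rw [div_eq_mul_inv]
          nlinarith [sq_nonneg ((p : ℝ)⁻¹)]
    _ = 4 * (∏ p ∈ z.primesBelow, (1 - (p : ℝ)⁻¹)) ^ 2 := by
        rw [prod_pow, hE]; ring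
    _ ≤ 4 * ((Real.log z)⁻¹) ^ 2 := by
        gcongr
        exact (prod_pos hpos).le
    _ = _ := by rw [inv_pow]; rfl

theorem primePi2_le_sifted (x : ℝ) (z : ℕ) :
    primePi2 x ≤ z +
      #{n ∈ range (⌊x⌋₊ + 1) | ∀ p ∈ z.primesBelow.erase 2, ¬ p ∣ n * (n + 2)} := by
  have hsub : (range (⌊x⌋₊ + 1)).filter
      (fun p : ℕ => p.Prime ∧ (p + 2).Prime ∧ (p : ℝ) ≤ x) ⊆ range z ∪
      {n ∈ range (⌊x⌋₊ + 1) | ∀ p ∈ z.primesBelow.erase 2, ¬ p ∣ n * (n + 2)} := by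
    intro n hn
    simp only [mem_filter, mem_union, mem_range, mem_erase, Nat.mem_primesBelow] at hn ⊢
    obtain ⟨hnx, hn1, hn2, -⟩ := hn
    by_cases hnz : n < z
    · exact .inl hnz
    · refine .inr ⟨hnx, ?_⟩
      rintro p ⟨-, hpz, hp⟩ hdvd
      rcases hp.dvd_mul.1 hdvd with h | h
      · have := (Nat.prime_dvd_prime_iff_eq hp hn1).1 h
        omega
      · have := (Nat.prime_dvd_prime_iff_eq hp hn2).1 h
        omega
  calc _ ≤ _ := card_le_card hsub
    _ ≤ _ := card_union_le _ _
    _ = _ := by rw [card_range]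

theorem primePi2_le_two_mul {x : ℝ} (hx : 1 ≤ x) : (primePi2 x : ℝ) ≤ 2 * x := by
  have h : primePi2 x ≤ ⌊x⌋₊ + 1 := (card_filter_le _ _).trans_eq (card_range _)
  have h' : (primePi2 x : ℝ) ≤ ⌊x⌋₊ + 1 := by exact_mod_cast h
  linarith [Nat.floor_le (zero_le_one.trans hx)]

/-- Brun's pure sieve with sifting limit `2 ^ J`, truncated at sets of at most `m` primes. -/
theorem primePi2_le_of_two_pow_le {x : ℝ} {J m : ℕ} (hx : 1 ≤ x) (hJ : 2 ≤ J) (hm : Even m)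
    (hJm : 26 * Real.log J ≤ m) (hpow : (2 : ℝ) ^ (J * (m + 2)) ≤ x) :
    (primePi2 x : ℝ) ≤ (33 + 2 * Real.exp 24 + Real.exp 2) * (x / J ^ 2) := by
  set z : ℕ := 2 ^ J with hz
  have hJz : J < z := Nat.lt_two_pow_self
  have hJ0 : (0 : ℝ) < J := by exact_mod_cast (by omega : 0 < J)
  have hJzR : (J : ℝ) ≤ z := by exact_mod_cast hJz.le
  have hz1 : (1 : ℝ) ≤ z := by exact_mod_cast (by omega : 1 ≤ z)
  have hm1 : 1 ≤ m := by
    have : 0 < Real.log J := Real.log_pos (by exact_mod_cast (by omega : 1 < J))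
    have : (0 : ℝ) < m := by linarith
    exact_mod_cast this
  have hzm : (z : ℝ) ^ m ≤ x / J ^ 2 := by
    rw [le_div_iff₀ (by positivity)]
    calc (z : ℝ) ^ m * J ^ 2 ≤ z ^ m * z ^ 2 := by gcongr
      _ = 2 ^ (J * (m + 2)) := by
          rw [← pow_add, hz]; push_cast; rw [← pow_mul]
      _ ≤ x := hpow
  set P := z.primesBelow.erase 2 with hPdef
  have hP : ∀ p ∈ P, p.Prime ∧ p ≠ 2 := fun p hp =>
    ⟨Nat.prime_of_mem_primesBelow (mem_of_mem_erase hp), ne_of_mem_erase hp⟩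
  have hPcard : (#P : ℝ) ≤ z := by
    have : #P ≤ z := (card_erase_le.trans (card_filter_le _ _)).trans_eq (card_range _)
    exact_mod_cast this
  have hmain : ∏ p ∈ P, (1 - 2 / p : ℝ) ≤ 16 / J ^ 2 := by
    refine (prod_primesBelow_erase_two_le (by omega : 2 < z)).trans ?_
    have hl2 : (1 : ℝ) / 2 ≤ Real.log 2 := by linarith [Real.log_two_gt_d9]
    have : (J : ℝ) / 2 ≤ Real.log z := by
      rw [hz, Nat.cast_pow, Real.log_pow]
      push_cast
      nlinarith
    calc 4 / Real.log z ^ 2 ≤ 4 / ((J : ℝ) / 2) ^ 2 := by gcongr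
      _ = _ := by field_simp; norm_num
  have hrecip : ∑ p ∈ P, (2 / p : ℝ) ≤ 8 * (1 + Real.log J) := by
    obtain ⟨j, rfl⟩ : ∃ j, J = j + 1 := ⟨J - 1, by omega⟩
    have hj : (1 : ℝ) ≤ j := by exact_mod_cast (by omega : 1 ≤ j)
    calc ∑ p ∈ P, (2 / p : ℝ) = 2 * ∑ p ∈ P, (p : ℝ)⁻¹ := by
          rw [mul_sum]; rfl
      _ ≤ 2 * ∑ p ∈ z.primesBelow, (p : ℝ)⁻¹ := by
          gcongr
          exact erase_subset _ _
      _ ≤ 2 * (4 * harmonic j) := by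
          gcongr
          exact sum_primesBelow_two_pow_inv_le j
      _ ≤ 2 * (4 * (1 + Real.log j)) := by
          gcongr
          exact harmonic_le_one_add_log j
      _ ≤ 2 * (4 * (1 + Real.log (j + 1 : ℕ))) := by
          gcongr
          omega
      _ = _ := by ring
  have htail : ∑ T ∈ P.powerset with m < #T, ∏ p ∈ T, (2 / p : ℝ) ≤ Real.exp 24 / J ^ 2 := by
    calc _ ≤ Real.exp (3 * ∑ p ∈ P, (2 / p : ℝ) - m) :=
          sum_powerset_lt_card_prod_le P m fun p => by positivity
      _ ≤ Real.exp (24 - (2 : ℕ) * Real.log J) := by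
          refine Real.exp_le_exp.2 ?_
          push_cast
          linarith
      _ = _ := by rw [Real.exp_sub, Real.exp_nat_mul, Real.exp_log hJ0]
  have hsift := card_sifted_le_sum (⌊x⌋₊ + 1) hP hm
  have herr := sum_powerset_card_le_two_pow_le P m hz1 hPcard
  have hN : ((⌊x⌋₊ + 1 : ℕ) : ℝ) ≤ 2 * x := by
    push_cast
    linarith [Nat.floor_le (zero_le_one.trans hx)]
  have hpi : (primePi2 x : ℝ) ≤ z +
      #{n ∈ range (⌊x⌋₊ + 1) | ∀ p ∈ P, ¬ p ∣ n * (n + 2)} := by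
    exact_mod_cast primePi2_le_sifted x z
  have hmid : ((⌊x⌋₊ + 1 : ℕ) : ℝ) *
      (∏ p ∈ P, (1 - 2 / p : ℝ) + ∑ T ∈ P.powerset with m < #T, ∏ p ∈ T, (2 / p : ℝ))
      ≤ 2 * x * (16 / J ^ 2 + Real.exp 24 / J ^ 2) := by
    calc _ ≤ ((⌊x⌋₊ + 1 : ℕ) : ℝ) * (16 / J ^ 2 + Real.exp 24 / J ^ 2) := by gcongr
      _ ≤ _ := by gcongr
  have hzzm : (z : ℝ) ≤ z ^ m := le_self_pow₀ hz1 (by omega)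
  calc (primePi2 x : ℝ)
      ≤ x / J ^ 2 + (2 * x * (16 / J ^ 2 + Real.exp 24 / J ^ 2) + Real.exp 2 * (x / J ^ 2)) := by
        have := mul_le_mul_of_nonneg_left hzm (Real.exp_pos 2).le
        linarith
    _ = _ := by ring

theorem exists_primePi2_le_of_log_large :
    ∃ C : ℝ, 0 < C ∧ ∀ x : ℝ, 14400 ≤ Real.log x → 1 ≤ x →
      (primePi2 x : ℝ) ≤ C * x * (Real.log (Real.log x)) ^ 2 / (Real.log x) ^ 2 := by
  refine ⟨(33 + 2 * Real.exp 24 + Real.exp 2) * 3600, by positivity, fun x hL hx => ?_⟩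
  set L := Real.log x with hLdef
  set l := Real.log L with hldef
  have hL0 : 0 < L := by linarith
  have hl1 : 1 ≤ l := by
    rw [hldef, Real.le_log_iff_exp_le hL0]
    linarith [Real.exp_one_lt_d9]
  have hl0 : 0 < l := by linarith
  have hLl : 60 * l ≤ L := by
    have h1 : l ≤ 2 * √L := by
      have := Real.log_le_self (Real.sqrt_nonneg L)
      rw [Real.log_sqrt hL0.le] at this
      linarith
    have h2 : 120 ≤ √L := Real.le_sqrt_of_sq_le (by linarith)
    nlinarith [Real.sq_sqrt hL0.le]
  set y := L / (30 * l) with hy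
  have hy2 : 2 ≤ y := by
    rw [hy, le_div_iff₀ (by positivity)]
    linarith
  set J := ⌊y⌋₊ with hJdef
  have hJ2 : 2 ≤ J := Nat.le_floor (by exact_mod_cast hy2)
  have hJ0 : (0 : ℝ) < J := by exact_mod_cast (by omega : 0 < J)
  have hJy : (J : ℝ) ≤ y := Nat.floor_le (by linarith)
  have hyJ : y / 2 ≤ J := by linarith [Nat.lt_floor_add_one y]
  have hyL : y ≤ L := div_le_self hL0.le (by linarith)
  have hlogJ : Real.log J ≤ l := Real.log_le_log hJ0 (hJy.trans hyL)
  have hlogJ0 : 0 ≤ Real.log J := Real.log_natCast_nonneg J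
  set k := ⌈13 * Real.log J⌉₊ with hk
  have hk1 : 13 * Real.log J ≤ k := Nat.le_ceil _
  have hk2 : (k : ℝ) < 13 * Real.log J + 1 := Nat.ceil_lt_add_one (by positivity)
  have hpow : (2 : ℝ) ^ (J * (2 * k + 2)) ≤ x := by
    rw [← Real.log_le_log_iff (by positivity) (by linarith), Real.log_pow]
    have hJk : ((J * (2 * k + 2) : ℕ) : ℝ) ≤ L := by
      push_cast
      calc (J : ℝ) * (2 * k + 2) ≤ y * (30 * l) := by
            gcongr
            linarith
        _ = L := by rw [hy]; field_simp
    have hlog2 : Real.log 2 ≤ 1 := by linarith [Real.log_two_lt_d9]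
    have hlog2' : 0 ≤ Real.log 2 := (Real.log_pos one_lt_two).le
    nlinarith
  have hfin := primePi2_le_of_two_pow_le hx hJ2 (even_two_mul k)
    (by push_cast; linarith) hpow
  refine hfin.trans ?_
  have : x / J ^ 2 ≤ x / (y / 2) ^ 2 := by gcongr
  calc _ ≤ (33 + 2 * Real.exp 24 + Real.exp 2) * (x / (y / 2) ^ 2) := by gcongr
    _ = _ := by
      rw [hy]
      field_simp
      norm_num

/-- Brun's theorem: `π₂(x) = O(x (log log x)² / log² x)`. -/
theorem statement16 :
    ∃ C : ℝ, 0 < C ∧ ∀ x : ℝ, 3 ≤ x →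
      (primePi2 x : ℝ) ≤ C * x * (Real.log (Real.log x)) ^ 2 / (Real.log x) ^ 2 := by
  obtain ⟨C, hC, h⟩ := exists_primePi2_le_of_log_large
  have hlog3 : 1 < Real.log 3 := by
    rw [Real.lt_log_iff_exp_lt (by norm_num)]
    linarith [Real.exp_one_lt_d9]
  set c := Real.log (Real.log 3) with hc
  have hc0 : 0 < c := Real.log_pos hlog3
  refine ⟨max C (2 * 14400 ^ 2 / c ^ 2), lt_max_of_lt_left hC, fun x hx => ?_⟩
  have hlog : Real.log 3 ≤ Real.log x := Real.log_le_log (by norm_num) hx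
  rcases le_total 14400 (Real.log x) with hL | hL
  · refine (h x hL (by linarith)).trans ?_
    gcongr
    exact le_max_left _ _
  · have hcl : c ≤ Real.log (Real.log x) := Real.log_le_log (by linarith) hlog
    have hL0 : 0 < Real.log x := by linarith
    calc (primePi2 x : ℝ) ≤ 2 * x := primePi2_le_two_mul (by linarith)
      _ = 2 * 14400 ^ 2 / c ^ 2 * x * c ^ 2 / 14400 ^ 2 := by field_simp
      _ ≤ _ := by
        gcongr
        exact le_max_right _ _
end

section
/- As y → ∞, (log y)² · ∏_{p prime, 2 < p ≤ y} (p−2)/p tends to 4 e^{−2γ} Π₂, where Π₂ = ∏_{p prime, p > 2} (1 − 1/(p−1)²) is the (convergent) twin prime constant; in particular the finite products ∏_{2 < p ≤ y} p(p−2)/(p−1)² converge to Π₂ as y → ∞. -/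
open Filter Finset

/-- The twin prime constant `Π₂ = ∏_{p prime, p > 2} (1 − 1/(p−1)²)`. -/
noncomputable def twinPrimeConst : ℝ :=
  ∏' p : Nat.Primes, if 2 < (p : ℕ) then 1 - 1 / ((p : ℝ) - 1) ^ 2 else 1

lemma log_factorial_eq_sum_primesLE (n : ℕ) :
    Real.log n.factorial =
      ∑ p ∈ Nat.primesLE n, (padicValNat p n.factorial : ℝ) * Real.log p := by
  have h : (n.factorial : ℝ) =
      ∏ p ∈ Nat.primesLE n, (p : ℝ) ^ padicValNat p n.factorial := by
    have := Nat.factorial_ne_zero n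
    have h2 := Nat.prod_pow_prime_padicValNat n.factorial this (n + 1 + n.factorial) (by omega)
    conv_lhs => rw [← h2]
    push_cast
    symm
    apply Finset.prod_subset
    · intro p hp
      simp only [Nat.mem_primesLE] at hp
      simp only [mem_filter, mem_range]
      exact ⟨by omega, hp.2⟩
    · intro p hp hp2
      simp only [mem_filter, mem_range] at hp
      simp only [Nat.mem_primesLE, not_and] at hp2
      rw [padicValNat.eq_zero_of_not_dvd, pow_zero]
      intro h3
      exact hp2 ((hp.2.dvd_factorial).1 h3) hp.2
  rw [h, Real.log_prod]
  · simp [Real.log_pow]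
  · intro p hp
    have := (Nat.prime_of_mem_primesLE hp).pos
    positivity

/-- An upper bound of Mertens type for `∑ log p / p`. -/
lemma sum_log_div_primesLE_le (n : ℕ) :
    ∑ p ∈ Nat.primesLE n, Real.log p / p ≤ Real.log n + Real.log 4 := by
  rcases n.eq_zero_or_pos with rfl | hn
  · simp [Real.log_nonneg]
  have hn' : (0 : ℝ) < n := by exact_mod_cast hn
  have h1 : Real.log n.factorial ≤ n * Real.log n := by
    rw [← Real.log_pow]
    apply Real.log_le_log (by exact_mod_cast n.factorial_pos)
    exact_mod_cast n.factorial_le_pow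
  have h2 := Chebyshev.theta_le_log4_mul_x hn'.le
  rw [Chebyshev.theta_eq_sum_primesLE_log] at h2
  have h3 : n * ∑ p ∈ Nat.primesLE n, Real.log p / p ≤
      Real.log n.factorial + ∑ p ∈ Nat.primesLE n, Real.log p := by
    rw [log_factorial_eq_sum_primesLE, mul_sum, ← sum_add_distrib]
    refine sum_le_sum fun p hp => ?_
    have hpp := Nat.prime_of_mem_primesLE hp
    have := Fact.mk hpp
    have hp0 : (0 : ℝ) < p := by exact_mod_cast hpp.pos
    have h4 : n / p ≤ padicValNat p n.factorial := by
      rw [← padicValNat_mul_div_factorial, padicValNat_factorial_mul]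
      omega
    have h5 : (n : ℝ) / p ≤ padicValNat p n.factorial + 1 := by
      have h6 : (n : ℝ) / p < ((n / p : ℕ) : ℝ) + 1 := by
        rw [div_lt_iff₀ hp0]
        exact_mod_cast Nat.lt_mul_of_div_lt (Nat.lt_succ_self _) hpp.pos
      have : ((n / p : ℕ) : ℝ) ≤ padicValNat p n.factorial := by exact_mod_cast h4
      linarith
    have hl : 0 ≤ Real.log p := Real.log_natCast_nonneg p
    calc (n : ℝ) * (Real.log p / p) = n / p * Real.log p := by ring
      _ ≤ (padicValNat p n.factorial + 1) * Real.log p := by gcongr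
      _ = _ := by ring
  have h7 : n * ∑ p ∈ Nat.primesLE n, Real.log p / p ≤ n * (Real.log n + Real.log 4) := by
    linarith
  exact le_of_mul_le_mul_left h7 hn'

lemma summable_log_div_mul_sub_one :
    Summable fun n : ℕ => Real.log n / (n * (n - 1)) := by
  have h : Summable fun n : ℕ => 4 * (1 / (n : ℝ) ^ (3 / 2 : ℝ)) :=
    (Real.summable_one_div_nat_rpow.2 (by norm_num)).mul_left 4
  refine Summable.of_norm_bounded_eventually_nat h ?_
  filter_upwards [eventually_ge_atTop 2] with n hn
  have hn' : (2 : ℝ) ≤ n := by exact_mod_cast hn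
  have hl : 0 ≤ Real.log n := Real.log_natCast_nonneg n
  have h1 : Real.log n ≤ (n : ℝ) ^ (1 / 2 : ℝ) / (1 / 2) :=
    Real.log_le_rpow_div (by linarith) (by norm_num)
  have h2 : (n : ℝ) ^ (1 / 2 : ℝ) * (n : ℝ) ^ (3 / 2 : ℝ) = n ^ 2 := by
    rw [← Real.rpow_add (by linarith)]; norm_num
  have h3 : 0 < (n : ℝ) ^ (3 / 2 : ℝ) := Real.rpow_pos_of_pos (by linarith) _
  rw [Real.norm_of_nonneg (div_nonneg hl (mul_nonneg (by linarith) (by linarith))), mul_one_div,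
    div_le_div_iff₀ (mul_pos (by linarith) (by linarith)) h3]
  calc Real.log n * (n : ℝ) ^ (3 / 2 : ℝ)
      ≤ (n : ℝ) ^ (1 / 2 : ℝ) / (1 / 2) * (n : ℝ) ^ (3 / 2 : ℝ) := by gcongr
    _ = 2 * n ^ 2 := by rw [← h2]; ring
    _ ≤ 4 * (n * (n - 1)) := by nlinarith

/-- A lower bound of Mertens type for `∑ log p / p`. -/
lemma exists_log_sub_le_sum_log_div_primesLE :
    ∃ K : ℝ, ∀ n : ℕ, Real.log n - K ≤ ∑ p ∈ Nat.primesLE n, Real.log p / p := by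
  refine ⟨1 + ∑' n : ℕ, Real.log n / (n * (n - 1)), fun n => ?_⟩
  have hnonneg : ∀ m : ℕ, 0 ≤ Real.log m / ((m : ℝ) * (m - 1)) := by
    intro m
    rcases m.eq_zero_or_pos with rfl | hm
    · simp
    · have : (1 : ℝ) ≤ m := by exact_mod_cast hm
      exact div_nonneg (Real.log_natCast_nonneg m) (mul_nonneg (by linarith) (by linarith))
  have hK : 0 ≤ ∑' n : ℕ, Real.log n / ((n : ℝ) * (n - 1)) := tsum_nonneg hnonneg
  rcases n.eq_zero_or_pos with rfl | hn
  · simp; linarith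
  have hn' : (0 : ℝ) < n := by exact_mod_cast hn
  have h1 : n * Real.log n - n ≤ Real.log n.factorial := by
    have h := Stirling.le_log_factorial_stirling hn.ne'
    have h2 : 0 ≤ Real.log n := Real.log_natCast_nonneg n
    have h3 : 0 ≤ Real.log (2 * Real.pi) :=
      Real.log_nonneg (by nlinarith [Real.pi_gt_three])
    linarith
  have h2 : Real.log n.factorial ≤ n * ∑ p ∈ Nat.primesLE n, Real.log p / p
      + n * ∑ p ∈ Nat.primesLE n, Real.log p / ((p : ℝ) * (p - 1)) := by
    rw [log_factorial_eq_sum_primesLE, mul_sum, mul_sum, ← sum_add_distrib]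
    refine sum_le_sum fun p hp => ?_
    have hpp := Nat.prime_of_mem_primesLE hp
    have := Fact.mk hpp
    have hp0 : (2 : ℝ) ≤ p := by exact_mod_cast hpp.two_le
    have h4 : ((p : ℝ) - 1) * padicValNat p n.factorial ≤ n := by
      have := (sub_one_mul_padicValNat_factorial_lt_of_ne_zero p hn.ne').le
      have h5 : (((p - 1 : ℕ) : ℝ)) * padicValNat p n.factorial ≤ n := by exact_mod_cast this
      rwa [Nat.cast_sub hpp.one_le, Nat.cast_one] at h5
    have hl : 0 ≤ Real.log p := Real.log_natCast_nonneg p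
    have h6 : (padicValNat p n.factorial : ℝ) ≤ n / (p - 1) := by
      rw [le_div_iff₀ (by linarith)]; linarith
    calc (padicValNat p n.factorial : ℝ) * Real.log p ≤ n / (p - 1) * Real.log p := by gcongr
      _ = _ := by
        have : (p : ℝ) - 1 ≠ 0 := by linarith
        field_simp
        ring
  have h3 : ∑ p ∈ Nat.primesLE n, Real.log p / ((p : ℝ) * (p - 1)) ≤
      ∑' n : ℕ, Real.log n / ((n : ℝ) * (n - 1)) :=
    summable_log_div_mul_sub_one.sum_le_tsum _ fun m _ => hnonneg m
  have h4 := mul_le_mul_of_nonneg_left h3 hn'.le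
  refine le_of_mul_le_mul_left ?_ hn'
  linarith

/-- Comparison of `b * log (b / a)` with `b - a`. -/
lemma mul_log_sub_log_sub_bounds {a b : ℝ} (ha : 0 < a) (hab : a ≤ b) :
    0 ≤ b * (Real.log b - Real.log a) - (b - a) ∧
      b * (Real.log b - Real.log a) - (b - a) ≤ (b - a) ^ 2 / a := by
  have hb : 0 < b := ha.trans_le hab
  have h1 := Real.log_le_sub_one_of_pos (div_pos hb ha)
  have h2 := Real.log_le_sub_one_of_pos (div_pos ha hb)
  rw [Real.log_div hb.ne' ha.ne'] at h1
  rw [Real.log_div ha.ne' hb.ne'] at h2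
  have h3 : b * (a / b) = a := by field_simp
  have h4 : b * (b / a - 1) - (b - a) = (b - a) ^ 2 / a := by field_simp
  constructor
  · nlinarith
  · nlinarith

/-- Mertens' second theorem, without identification of the constant. -/
lemma exists_tendsto_sum_primesLE_inv_sub_log_log :
    ∃ M : ℝ, Tendsto (fun n : ℕ => ∑ p ∈ Nat.primesLE n, (1 / p : ℝ) - Real.log (Real.log n))
      atTop (nhds M) := by
  set c : ℕ → ℝ := fun n => if n.Prime then Real.log n / n else 0
  set e : ℕ → ℝ := fun n => Real.log (n + 3) *
    (Real.log (Real.log (n + 3)) - Real.log (Real.log (n + 2))) -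
      (Real.log (n + 3) - Real.log (n + 2))
  obtain ⟨K, hK⟩ := exists_log_sub_le_sum_log_div_primesLE
  have hstep : ∀ (f : ℕ → ℝ) (n : ℕ), ∑ p ∈ Nat.primesLE (n + 2), f p =
      f 2 + ∑ i ∈ range n, (if (i + 3).Prime then f (i + 3) else 0) := by
    intro f n
    rw [Nat.primesLE_eq_filter_range, sum_filter]
    induction n with
    | zero => simp [sum_range_succ, Nat.prime_two, Nat.not_prime_zero, Nat.not_prime_one]
    | succ k ih => rw [sum_range_succ, ih, sum_range_succ, add_assoc]
  have hl2 : 0 < Real.log 2 := Real.log_pos (by norm_num)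
  have hlog : ∀ n : ℕ, Real.log 2 ≤ Real.log (n + 2) := fun n =>
    Real.log_le_log (by norm_num) (by linarith [(Nat.cast_nonneg n : (0 : ℝ) ≤ n)])
  have hmono : ∀ n : ℕ, Real.log (n + 2) ≤ Real.log (n + 3) := fun n =>
    Real.log_le_log (by positivity) (by linarith)
  have he : ∀ n, 0 ≤ e n ∧ e n ≤ 1 / Real.log 2 * (1 / ((n : ℝ) + 1) ^ 2) := by
    intro n
    have ha : 0 < Real.log (n + 2) := hl2.trans_le (hlog n)
    obtain ⟨h1, h2⟩ := mul_log_sub_log_sub_bounds ha (hmono n)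
    refine ⟨h1, h2.trans ?_⟩
    have h3 : Real.log (n + 3) - Real.log (n + 2) ≤ 1 / ((n : ℝ) + 1) := by
      rw [← Real.log_div (by positivity) (by positivity)]
      refine (Real.log_le_sub_one_of_pos (by positivity)).trans ?_
      rw [div_sub_one (by positivity), div_le_div_iff₀ (by positivity) (by positivity)]
      nlinarith
    have h4 : 0 ≤ Real.log (n + 3) - Real.log (n + 2) := sub_nonneg.2 (hmono n)
    calc _ ≤ (1 / ((n : ℝ) + 1)) ^ 2 / Real.log 2 := by
          exact div_le_div₀ (by positivity) (pow_le_pow_left₀ h4 h3 2) hl2 (hlog n)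
      _ = _ := by field_simp
  have hesum : Summable e := by
    refine Summable.of_nonneg_of_le (fun n => (he n).1) (fun n => (he n).2) (.mul_left _ ?_)
    have := (summable_nat_add_iff 1).2 (Real.summable_one_div_nat_pow.2 (one_lt_two))
    simpa using this
  set z : ℕ → ℝ := fun n => c (n + 3) - Real.log (n + 3) *
    (Real.log (Real.log (n + 3)) - Real.log (Real.log (n + 2)))
  have hz : ∀ n, ∑ i ∈ range n, z i = ∑ p ∈ Nat.primesLE (n + 2), Real.log p / p
      - Real.log (n + 2) - ∑ i ∈ range n, e i + Real.log 2 / 2 := by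
    intro n
    have htel : ∑ i ∈ range n, (Real.log (i + 3) - Real.log (i + 2)) =
        Real.log (n + 2) - Real.log 2 := by
      have := Finset.sum_range_sub (fun i : ℕ => Real.log (i + 2)) n
      simp only [Nat.cast_add, Nat.cast_one, Nat.cast_zero, zero_add] at this
      rw [← this]
      refine sum_congr rfl fun i _ => by rw [show (i : ℝ) + 1 + 2 = i + 3 by ring]
    rw [hstep]
    simp only [z, e, sum_sub_distrib] at htel ⊢
    have : ∑ i ∈ range n, c (i + 3) = ∑ i ∈ range n,
      (if (i + 3).Prime then Real.log ((i + 3 : ℕ) : ℝ) / ((i + 3 : ℕ) : ℝ) else 0) := rfl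
    rw [this]
    push_cast
    linarith
  have hb : ∀ n, ‖∑ i ∈ range n, z i‖ ≤ |K| + Real.log 4 + ∑' i, e i + Real.log 2 := by
    intro n
    have h1 := hK (n + 2)
    have h2 := sum_log_div_primesLE_le (n + 2)
    have h3 := hesum.sum_le_tsum (range n) fun i _ => (he i).1
    have h4 : 0 ≤ ∑ i ∈ range n, e i := sum_nonneg fun i _ => (he i).1
    have h5 : 0 ≤ Real.log 4 := Real.log_nonneg (by norm_num)
    have h6 := neg_abs_le K
    have h7 := le_abs_self K
    rw [hz, Real.norm_eq_abs, abs_le]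
    push_cast at h1 h2
    constructor <;> linarith
  have hanti : Antitone fun n : ℕ => (Real.log (n + 3))⁻¹ := by
    intro m n hmn
    have hm : Real.log 2 ≤ Real.log (m + 3) := (hlog m).trans (hmono m)
    refine inv_anti₀ (hl2.trans_le hm) (Real.log_le_log (by positivity) ?_)
    have : (m : ℝ) ≤ n := by exact_mod_cast hmn
    linarith
  have hzero : Tendsto (fun n : ℕ => (Real.log (n + 3))⁻¹) atTop (nhds 0) :=
    (Real.tendsto_log_atTop.comp
      (tendsto_atTop_add_const_right _ _ tendsto_natCast_atTop_atTop)).inv_tendsto_atTop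
  obtain ⟨L, hL⟩ := cauchySeq_tendsto_of_complete
    (hanti.cauchySeq_series_mul_of_tendsto_zero_of_bounded hzero hb)
  refine ⟨1 / 2 + L - Real.log (Real.log 2), (tendsto_add_atTop_iff_nat 2).1 ?_⟩
  refine ((hL.const_add (1 / 2)).sub_const (Real.log (Real.log 2))).congr fun n => ?_
  have htel : ∑ i ∈ range n, (Real.log (Real.log (i + 3)) - Real.log (Real.log (i + 2))) =
      Real.log (Real.log (n + 2)) - Real.log (Real.log 2) := by
    have := Finset.sum_range_sub (fun i : ℕ => Real.log (Real.log (i + 2))) n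
    simp only [Nat.cast_add, Nat.cast_one, Nat.cast_zero, zero_add] at this
    rw [← this]
    refine sum_congr rfl fun i _ => by rw [show (i : ℝ) + 1 + 2 = i + 3 by ring]
  have hterm : ∀ i : ℕ, (Real.log (i + 3))⁻¹ • z i =
      (if (i + 3).Prime then 1 / ((i + 3 : ℕ) : ℝ) else 0) -
        (Real.log (Real.log (i + 3)) - Real.log (Real.log (i + 2))) := by
    intro i
    have hne : Real.log ((i : ℝ) + 3) ≠ 0 := (hl2.trans_le ((hlog i).trans (hmono i))).ne'
    simp only [z, c, smul_eq_mul]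
    push_cast
    split_ifs <;> (field_simp; try ring)
  rw [sum_congr rfl fun i _ => hterm i, sum_sub_distrib, htel,
    hstep (fun p => 1 / (p : ℝ))]
  push_cast
  ring

section Laplace

open MeasureTheory Set

/-- The step function `t ↦ ∑_{l n ≤ t} a n`. -/
noncomputable def stepSum (a l : ℕ → ℝ) (t : ℝ) : ℝ := ∑' n, if l n ≤ t then a n else 0

variable {a l : ℕ → ℝ}

lemma summable_stepSum (ha : ∀ n, 0 ≤ a n) (h : Summable fun n => a n * Real.exp (-l n)) (t : ℝ) :
    Summable fun n => if l n ≤ t then a n else 0 := by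
  refine Summable.of_nonneg_of_le (fun n => ?_) (fun n => ?_) (h.mul_left (Real.exp t))
  · split_ifs
    exacts [ha n, le_rfl]
  · split_ifs with hn
    · have h1 : (1 : ℝ) ≤ Real.exp (t - l n) := Real.one_le_exp (by linarith)
      calc a n ≤ a n * Real.exp (t - l n) := le_mul_of_one_le_right (ha n) h1
        _ = _ := by rw [sub_eq_add_neg, Real.exp_add]; ring
    · exact mul_nonneg (Real.exp_pos _).le (mul_nonneg (ha n) (Real.exp_pos _).le)

lemma stepSum_nonneg (ha : ∀ n, 0 ≤ a n) (t : ℝ) : 0 ≤ stepSum a l t :=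
  tsum_nonneg fun n => by split_ifs; exacts [ha n, le_rfl]

lemma monotone_stepSum (ha : ∀ n, 0 ≤ a n) (h : Summable fun n => a n * Real.exp (-l n)) :
    Monotone (stepSum a l) := by
  intro s t hst
  refine (summable_stepSum ha h s).tsum_le_tsum (fun n => ?_) (summable_stepSum ha h t)
  split_ifs with h1 h2 h2
  exacts [le_rfl, absurd (h1.trans hst) h2, ha n, le_rfl]

/-- A generalized Dirichlet series is the Laplace transform of its summatory function. -/
lemma integral_stepSum_mul_exp (ha : ∀ n, 0 ≤ a n) (hl : ∀ n, 0 ≤ l n) {δ : ℝ} (hδ : 0 < δ)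
    (h : Summable fun n => a n * Real.exp (-(δ * l n))) :
    ∫ u in Ioi (0 : ℝ), stepSum a l (u / δ) * Real.exp (-u) =
      ∑' n, a n * Real.exp (-(δ * l n)) := by
  set F : ℕ → ℝ → ℝ := fun n => (Ici (δ * l n)).indicator fun u => a n * Real.exp (-u)
  have hexp : ∀ n, IntegrableOn (fun u => a n * Real.exp (-u)) (Ioi 0) := fun n =>
    (integrableOn_exp_neg_Ioi 0).const_mul _
  have hF : ∀ n, Integrable (F n) (volume.restrict (Ioi 0)) := fun n =>
    (hexp n).indicator measurableSet_Ici
  have hval : ∀ n, ∫ u in Ioi (0 : ℝ), F n u = a n * Real.exp (-(δ * l n)) := by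
    intro n
    have hc : 0 ≤ δ * l n := mul_nonneg hδ.le (hl n)
    have hset : (Ioi 0 ∩ Ici (δ * l n) : Set ℝ) =ᵐ[volume] Ioi (δ * l n) := by
      have h1 : (Ioi 0 ∩ Ioi (δ * l n) : Set ℝ) = Ioi (δ * l n) := by
        rw [Ioi_inter_Ioi, sup_eq_right.2 hc]
      conv_rhs => rw [← h1]
      exact (ae_eq_refl _).inter Ioi_ae_eq_Ici.symm
    rw [setIntegral_indicator measurableSet_Ici, setIntegral_congr_set hset,
      integral_const_mul, integral_exp_neg_Ioi]
  have hnn : ∀ n u, 0 ≤ F n u := fun n u =>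
    indicator_nonneg (fun u _ => mul_nonneg (ha n) (Real.exp_pos _).le) u
  have hsum : Summable fun n => ∫ u in Ioi (0 : ℝ), ‖F n u‖ := by
    simp_rw [Real.norm_of_nonneg (hnn _ _), hval]
    exact h
  have key := integral_tsum_of_summable_integral_norm hF hsum
  simp_rw [hval] at key
  rw [key]
  refine integral_congr_ae (ae_of_all _ fun u => ?_)
  simp only [stepSum, ← tsum_mul_right]
  refine tsum_congr fun n => ?_
  simp only [F, indicator_apply, Set.mem_Ici, le_div_iff₀ hδ, mul_comm (l n) δ, ite_mul, zero_mul]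

lemma integrableOn_stepSum_mul_exp (ha : ∀ n, 0 ≤ a n) (hl : ∀ n, 0 ≤ l n) {n : ℕ} (hn : 0 < a n)
    {δ : ℝ} (hδ : 0 < δ) (h : Summable fun n => a n * Real.exp (-(δ * l n))) :
    IntegrableOn (fun u => stepSum a l (u / δ) * Real.exp (-u)) (Ioi 0) := by
  refine Integrable.of_integral_ne_zero ?_
  rw [integral_stepSum_mul_exp ha hl hδ h]
  exact (h.tsum_pos (fun m => mul_nonneg (ha m) (Real.exp_pos _).le) n
    (mul_pos hn (Real.exp_pos _))).ne'

/-- An Abelian theorem for the Laplace transform of a bounded function. -/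
lemma tendsto_integral_comp_div_mul_exp {f : ℝ → ℝ} (hf : Measurable f) {B L : ℝ}
    (hB : ∀ t, 0 ≤ t → |f t| ≤ B) (hL : Tendsto f atTop (nhds L)) :
    Tendsto (fun δ : ℝ => ∫ u in Ioi (0 : ℝ), f (u / δ) * Real.exp (-u))
      (nhdsWithin 0 (Ioi 0)) (nhds L) := by
  have h1 : ∫ u in Ioi (0 : ℝ), L * Real.exp (-u) = L := by
    rw [integral_const_mul, integral_exp_neg_Ioi_zero, mul_one]
  rw [← h1]
  refine tendsto_integral_filter_of_dominated_convergence (fun u => B * Real.exp (-u)) ?_ ?_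
    ((integrableOn_exp_neg_Ioi 0).const_mul _) ?_
  · refine Eventually.of_forall fun δ => Measurable.aestronglyMeasurable ?_
    exact (hf.comp (measurable_id.div_const δ)).mul (Real.measurable_exp.comp measurable_neg)
  · filter_upwards [self_mem_nhdsWithin] with δ hδ
    filter_upwards [ae_restrict_mem measurableSet_Ioi] with u hu
    rw [norm_mul, Real.norm_of_nonneg (Real.exp_pos (-u)).le]
    exact mul_le_mul_of_nonneg_right (hB _ (div_nonneg (le_of_lt hu) (le_of_lt hδ)))
      (Real.exp_pos _).le
  · filter_upwards [ae_restrict_mem measurableSet_Ioi] with u hu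
    have h2 : Tendsto (fun δ : ℝ => u / δ) (nhdsWithin 0 (Ioi 0)) atTop :=
      tendsto_inv_nhdsGT_zero.const_mul_atTop hu
    exact (hL.comp h2).mul_const _

/-- If two summatory functions differ by `L + o(1)` at infinity, the corresponding generalized
Dirichlet series differ by `L + o(1)` at `0`. -/
lemma tendsto_tsum_mul_exp_sub {b m : ℕ → ℝ} (ha : ∀ n, 0 ≤ a n) (hl : ∀ n, 0 ≤ l n)
    (hb : ∀ n, 0 ≤ b n) (hm : ∀ n, 0 ≤ m n) (ha' : ∃ n, 0 < a n) (hb' : ∃ n, 0 < b n)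
    (has : ∀ δ, 0 < δ → Summable fun n => a n * Real.exp (-(δ * l n)))
    (hbs : ∀ δ, 0 < δ → Summable fun n => b n * Real.exp (-(δ * m n))) {L : ℝ}
    (hL : Tendsto (fun t => stepSum a l t - stepSum b m t) atTop (nhds L)) :
    Tendsto (fun δ : ℝ => ∑' n, a n * Real.exp (-(δ * l n)) - ∑' n, b n * Real.exp (-(δ * m n)))
      (nhdsWithin 0 (Ioi 0)) (nhds L) := by
  obtain ⟨i, hi⟩ := ha'
  obtain ⟨j, hj⟩ := hb'
  have hma := monotone_stepSum (l := l) ha (by simpa using has 1 one_pos)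
  have hmb := monotone_stepSum (l := m) hb (by simpa using hbs 1 one_pos)
  obtain ⟨T, hT⟩ := eventually_atTop.1 (hL.eventually (Metric.ball_mem_nhds L one_pos))
  have hbound : ∀ t, 0 ≤ t → |stepSum a l t - stepSum b m t| ≤
      (|L| + 1) + (stepSum a l T + stepSum b m T) := by
    intro t _
    have h0 := stepSum_nonneg (l := l) ha
    have h0' := stepSum_nonneg (l := m) hb
    rcases le_total T t with h | h
    · have h1 := hT t h
      rw [Real.dist_eq] at h1
      have h2 := abs_sub_abs_le_abs_sub (stepSum a l t - stepSum b m t) L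
      linarith [h0 T, h0' T]
    · have h1 := hma h
      have h2 := hmb h
      have h3 := abs_nonneg L
      rw [abs_le]
      constructor <;> linarith [h0 T, h0' T, h0 t, h0' t]
  refine (tendsto_integral_comp_div_mul_exp (hma.measurable.sub hmb.measurable) hbound
    hL).congr' ?_
  filter_upwards [self_mem_nhdsWithin] with δ hδ
  rw [← integral_stepSum_mul_exp ha hl hδ (has δ hδ), ← integral_stepSum_mul_exp hb hm hδ (hbs δ hδ),
    ← integral_sub (integrableOn_stepSum_mul_exp ha hl hi hδ (has δ hδ))
      (integrableOn_stepSum_mul_exp hb hm hj hδ (hbs δ hδ))]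
  simp only [Pi.sub_apply, sub_mul]

end Laplace

lemma tendsto_log_floor_sub_log :
    Tendsto (fun x : ℝ => Real.log ⌊x⌋₊ - Real.log x) atTop (nhds 0) := by
  have h := (Real.continuousAt_log one_ne_zero).tendsto.comp
    (tendsto_nat_floor_div_atTop (R := ℝ))
  rw [Real.log_one] at h
  refine h.congr' ?_
  filter_upwards [eventually_ge_atTop 1] with x hx
  have h1 : (⌊x⌋₊ : ℝ) ≠ 0 := by exact_mod_cast (Nat.floor_pos.2 hx).ne'
  rw [Function.comp_apply, Real.log_div h1 (by linarith)]

lemma tendsto_log_log_floor_sub_log_log :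
    Tendsto (fun x : ℝ => Real.log (Real.log ⌊x⌋₊) - Real.log (Real.log x)) atTop (nhds 0) := by
  have h0 : Tendsto (fun x : ℝ => (Real.log ⌊x⌋₊ - Real.log x) * (Real.log x)⁻¹ + 1) atTop
      (nhds 1) := by
    simpa using (tendsto_log_floor_sub_log.mul Real.tendsto_log_atTop.inv_tendsto_atTop).add_const 1
  have h := (Real.continuousAt_log one_ne_zero).tendsto.comp h0
  rw [Real.log_one] at h
  refine h.congr' ?_
  filter_upwards [eventually_ge_atTop 2] with x hx
  have h1 : (2 : ℝ) ≤ ⌊x⌋₊ := by exact_mod_cast Nat.le_floor (by exact_mod_cast hx)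
  have h2 : 0 < Real.log ⌊x⌋₊ := Real.log_pos (by linarith)
  have h3 : 0 < Real.log x := Real.log_pos (by linarith)
  rw [Function.comp_apply, ← Real.log_div h2.ne' h3.ne']
  congr 1
  field_simp
  ring

lemma tendsto_sum_primesLE_floor_sub_log_log {f : ℕ → ℝ} {M : ℝ}
    (h : Tendsto (fun n : ℕ => ∑ p ∈ Nat.primesLE n, f p - Real.log (Real.log n))
      atTop (nhds M)) :
    Tendsto (fun x : ℝ => ∑ p ∈ Nat.primesLE ⌊x⌋₊, f p - Real.log (Real.log x))
      atTop (nhds M) := by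
  have h1 := (h.comp (tendsto_nat_floor_atTop (α := ℝ))).add tendsto_log_log_floor_sub_log_log
  rw [add_zero] at h1
  refine h1.congr fun x => ?_
  simp

lemma stepSum_prime_log (t : ℝ) :
    stepSum (fun n => if n.Prime then (1 / n : ℝ) else 0) (fun n => Real.log n) t =
      ∑ p ∈ Nat.primesLE ⌊Real.exp t⌋₊, (1 / p : ℝ) := by
  rw [stepSum, tsum_eq_sum (s := Nat.primesLE ⌊Real.exp t⌋₊)]
  · refine sum_congr rfl fun p hp => ?_
    obtain ⟨h1, h2⟩ := Nat.mem_primesLE.1 hp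
    have hp0 : (0 : ℝ) < p := by exact_mod_cast h2.pos
    rw [if_pos ((Real.log_le_iff_le_exp hp0).2 ((Nat.le_floor_iff (Real.exp_pos t).le).1 h1)),
      if_pos h2]
  · intro p hp
    split_ifs with h1 h2
    · have hp0 : (0 : ℝ) < p := by exact_mod_cast h2.pos
      exact absurd (Nat.mem_primesLE.2 ⟨(Nat.le_floor_iff (Real.exp_pos t).le).2
        ((Real.log_le_iff_le_exp hp0).1 h1), h2⟩) hp
    all_goals rfl

lemma stepSum_one_div_natCast {t : ℝ} (ht : 0 ≤ t) :
    stepSum (fun n => (1 / n : ℝ)) (fun n => n) t = harmonic ⌊t⌋₊ := by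
  rw [stepSum, tsum_eq_sum (s := Icc 1 ⌊t⌋₊), harmonic_eq_sum_Icc]
  · push_cast
    refine sum_congr rfl fun n hn => ?_
    rw [if_pos ((Nat.le_floor_iff ht).1 (mem_Icc.1 hn).2), one_div]
  · intro n hn
    split_ifs with h1
    · rcases n.eq_zero_or_pos with rfl | h2
      · simp
      · exact absurd (mem_Icc.2 ⟨h2, (Nat.le_floor_iff ht).2 h1⟩) hn
    · rfl

/-- The remainder `-log (1 - x) - x`. -/
noncomputable def logRemainder (x : ℝ) : ℝ := -Real.log (1 - x) - x

lemma abs_logRemainder_le {x : ℝ} (h0 : 0 ≤ x) (h1 : x ≤ 1 / 2) :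
    |logRemainder x| ≤ 2 * x ^ 2 := by
  have h := Real.abs_log_sub_add_sum_range_le (x := x) (by rw [abs_of_nonneg h0]; linarith) 1
  simp only [sum_range_one, zero_add, pow_one, Nat.cast_zero, div_one, abs_of_nonneg h0] at h
  rw [logRemainder, ← abs_neg, show -(-Real.log (1 - x) - x) = x + Real.log (1 - x) by ring]
  refine h.trans ?_
  rw [div_le_iff₀ (by linarith), one_add_one_eq_two]
  nlinarith [mul_nonneg (sq_nonneg x) (by linarith : (0 : ℝ) ≤ 1 - 2 * x)]

lemma summable_primes_inv_sq : Summable fun p : Nat.Primes => 2 * ((p : ℝ)⁻¹) ^ 2 := by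
  have h := (Nat.Primes.summable_rpow (r := -2)).2 (by norm_num)
  refine (h.congr fun p => ?_).mul_left 2
  rw [Real.rpow_neg (Nat.cast_nonneg _), inv_pow]
  norm_cast

lemma primes_rpow_bounds (p : Nat.Primes) {δ : ℝ} (hδ : 0 ≤ δ) :
    0 ≤ (p : ℝ) ^ (-(1 + δ)) ∧ (p : ℝ) ^ (-(1 + δ)) ≤ (p : ℝ)⁻¹ ∧ (p : ℝ)⁻¹ ≤ 1 / 2 := by
  have hp : (2 : ℝ) ≤ p := by exact_mod_cast p.2.two_le
  refine ⟨by positivity, ?_, ?_⟩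
  · rw [← Real.rpow_neg_one]
    exact Real.rpow_le_rpow_of_exponent_le (by linarith) (by linarith)
  · rw [one_div]
    exact inv_anti₀ two_pos hp

lemma abs_logRemainder_primes_rpow_le (p : Nat.Primes) {δ : ℝ} (hδ : 0 ≤ δ) :
    |logRemainder ((p : ℝ) ^ (-(1 + δ)))| ≤ 2 * ((p : ℝ)⁻¹) ^ 2 := by
  obtain ⟨h1, h2, h3⟩ := primes_rpow_bounds p hδ
  refine (abs_logRemainder_le h1 (h2.trans h3)).trans ?_
  gcongr

lemma summable_logRemainder {δ : ℝ} (hδ : 0 ≤ δ) :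
    Summable fun p : Nat.Primes => logRemainder ((p : ℝ) ^ (-(1 + δ))) :=
  summable_primes_inv_sq.of_norm_bounded fun p => abs_logRemainder_primes_rpow_le p hδ

lemma tendsto_tsum_logRemainder :
    Tendsto (fun δ : ℝ => ∑' p : Nat.Primes, logRemainder ((p : ℝ) ^ (-(1 + δ))))
      (nhdsWithin 0 (Set.Ioi 0)) (nhds (∑' p : Nat.Primes, logRemainder (p : ℝ)⁻¹)) := by
  refine tendsto_tsum_of_dominated_convergence summable_primes_inv_sq (fun p => ?_) ?_
  · have hp : (2 : ℝ) ≤ p := by exact_mod_cast p.2.two_le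
    have hc : ContinuousAt (fun δ : ℝ => logRemainder ((p : ℝ) ^ (-(1 + δ)))) 0 := by
      have h1 : ContinuousAt (fun δ : ℝ => (p : ℝ) ^ (-(1 + δ))) 0 :=
        ContinuousAt.rpow (by fun_prop) (by fun_prop) (Or.inl (by positivity))
      refine ((ContinuousAt.log (by fun_prop) ?_).neg).sub h1
      obtain ⟨-, h2, h3⟩ := primes_rpow_bounds p le_rfl
      exact (sub_pos.2 ((h2.trans h3).trans_lt one_half_lt_one)).ne'
    have := hc.tendsto.mono_left (nhdsWithin_le_nhds (s := Set.Ioi 0))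
    rwa [add_zero, Real.rpow_neg_one] at this
  · filter_upwards [self_mem_nhdsWithin] with δ hδ p
    exact abs_logRemainder_primes_rpow_le p (le_of_lt hδ)

lemma summable_primes_rpow {δ : ℝ} (hδ : 0 < δ) :
    Summable fun p : Nat.Primes => (p : ℝ) ^ (-(1 + δ)) :=
  Nat.Primes.summable_rpow.2 (by linarith)

lemma riemannZeta_eq_exp_tsum {δ : ℝ} (hδ : 0 < δ) :
    riemannZeta ((1 + δ : ℝ) : ℂ) =
      ((Real.exp (∑' p : Nat.Primes, -Real.log (1 - (p : ℝ) ^ (-(1 + δ)))) : ℝ) : ℂ) := by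
  rw [← riemannZeta_eulerProduct_exp_log (by simpa using hδ), Complex.ofReal_exp,
    Complex.ofReal_tsum]
  congr 1
  refine tsum_congr fun p => ?_
  have h := primes_rpow_bounds p hδ.le
  rw [Complex.ofReal_neg, Complex.ofReal_log (by linarith), Complex.ofReal_sub, Complex.ofReal_one,
    Complex.ofReal_cpow (Nat.cast_nonneg _)]
  push_cast
  rfl

lemma tendsto_log_zeta_add_log :
    Tendsto (fun δ : ℝ => ∑' p : Nat.Primes, -Real.log (1 - (p : ℝ) ^ (-(1 + δ))) + Real.log δ)
      (nhdsWithin 0 (Set.Ioi 0)) (nhds 0) := by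
  have h1 : Tendsto (fun δ : ℝ => ((1 + δ : ℝ) : ℂ)) (nhdsWithin 0 (Set.Ioi 0))
      (nhdsWithin 1 {1}ᶜ) := by
    refine tendsto_nhdsWithin_iff.2 ⟨?_, ?_⟩
    · have : ContinuousAt (fun δ : ℝ => ((1 + δ : ℝ) : ℂ)) 0 := by fun_prop
      simpa using this.tendsto.mono_left (nhdsWithin_le_nhds (s := Set.Ioi 0))
    · filter_upwards [self_mem_nhdsWithin] with δ hδ
      simpa using (ne_of_gt hδ)
  have h2 := Complex.continuous_re.tendsto _ |>.comp (riemannZeta_residue_one.comp h1)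
  have h3 := (Real.continuousAt_log one_ne_zero).tendsto.comp h2
  rw [Real.log_one] at h3
  refine h3.congr' ?_
  filter_upwards [self_mem_nhdsWithin] with δ hδ
  simp only [Function.comp_apply]
  rw [riemannZeta_eq_exp_tsum hδ, ← Complex.ofReal_one, ← Complex.ofReal_sub, ← Complex.ofReal_mul,
    Complex.ofReal_re, add_sub_cancel_left, Real.log_mul (ne_of_gt hδ) (Real.exp_pos _).ne',
    Real.log_exp, add_comm]

lemma tendsto_log_one_sub_exp_sub_log :
    Tendsto (fun δ : ℝ => Real.log (1 - Real.exp (-δ)) - Real.log δ)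
      (nhdsWithin 0 (Set.Ioi 0)) (nhds 0) := by
  have hd : HasDerivAt (fun δ : ℝ => 1 - Real.exp (-δ)) 1 0 := by
    simpa using ((hasDerivAt_neg (0 : ℝ)).exp).const_sub 1
  have h1 := hd.tendsto_slope_zero_right
  have h2 := (Real.continuousAt_log one_ne_zero).tendsto.comp h1
  rw [Real.log_one] at h2
  refine h2.congr' ?_
  filter_upwards [self_mem_nhdsWithin] with δ hδ
  have hδ' : (0 : ℝ) < δ := hδ
  have h3 : 0 < 1 - Real.exp (-δ) := by
    have := Real.exp_lt_one_iff.2 (neg_lt_zero.2 hδ')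
    linarith
  simp only [Function.comp_apply, zero_add, neg_zero, Real.exp_zero, sub_self, sub_zero, smul_eq_mul]
  rw [Real.log_mul (inv_pos.2 hδ').ne' h3.ne', Real.log_inv]
  ring

lemma hasSum_one_div_mul_exp {δ : ℝ} (hδ : 0 < δ) :
    HasSum (fun n : ℕ => (1 / n : ℝ) * Real.exp (-(δ * n))) (-Real.log (1 - Real.exp (-δ))) := by
  have h := Real.hasSum_pow_div_log_of_abs_lt_one (x := Real.exp (-δ))
    (by rw [abs_of_pos (Real.exp_pos _)]; exact Real.exp_lt_one_iff.2 (by linarith))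
  refine (hasSum_nat_add_iff' 1).1 ?_
  simp only [sum_range_one, Nat.cast_zero, div_zero, zero_mul, sub_zero]
  refine h.congr_fun fun n => ?_
  rw [← Real.exp_nat_mul]
  push_cast
  rw [show ((n : ℝ) + 1) * -δ = -(δ * (n + 1)) by ring]
  ring

lemma hasSum_prime_mul_exp_log {δ : ℝ} (hδ : 0 < δ) :
    HasSum (fun n : ℕ => (if n.Prime then (1 / n : ℝ) else 0) * Real.exp (-(δ * Real.log n)))
      (∑' p : Nat.Primes, (p : ℝ) ^ (-(1 + δ))) := by
  have h := (Nat.Primes.hasSum_iff_hasSum_ite (f := fun n : ℕ => (n : ℝ) ^ (-(1 + δ)))).1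
    (summable_primes_rpow hδ).hasSum
  refine h.congr_fun fun n => ?_
  split_ifs with hn
  · have hn0 : (0 : ℝ) < n := by exact_mod_cast hn.pos
    rw [neg_add, Real.rpow_add hn0, Real.rpow_neg_one, one_div, Real.rpow_def_of_pos hn0]
    congr 2
    ring
  · simp

/-- Mertens' second theorem, with the constant. -/
lemma tendsto_sum_primesLE_inv_sub_log_log :
    Tendsto (fun n : ℕ => ∑ p ∈ Nat.primesLE n, (1 / p : ℝ) - Real.log (Real.log n)) atTop
      (nhds (Real.eulerMascheroniConstant - ∑' p : Nat.Primes, logRemainder (p : ℝ)⁻¹)) := by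
  obtain ⟨M, hM⟩ := exists_tendsto_sum_primesLE_inv_sub_log_log
  have hstep : Tendsto (fun t => stepSum (fun n => if n.Prime then (1 / n : ℝ) else 0)
      (fun n => Real.log n) t - stepSum (fun n => (1 / n : ℝ)) (fun n => n) t) atTop
      (nhds (M - Real.eulerMascheroniConstant)) := by
    have h1 := (tendsto_sum_primesLE_floor_sub_log_log (f := fun p => (1 / p : ℝ)) hM).comp
      Real.tendsto_exp_atTop
    have h2 := (Real.tendsto_harmonic_sub_log.comp (tendsto_nat_floor_atTop (α := ℝ))).add
      tendsto_log_floor_sub_log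
    rw [add_zero] at h2
    refine (h1.sub h2).congr' ?_
    filter_upwards [eventually_ge_atTop 0] with t ht
    rw [stepSum_prime_log, stepSum_one_div_natCast ht]
    simp only [Function.comp_apply, Real.log_exp]
    ring
  have key := tendsto_tsum_mul_exp_sub (fun n => by split_ifs <;> positivity)
    (fun n => Real.log_natCast_nonneg n) (fun n => by positivity) (fun n => Nat.cast_nonneg n)
    ⟨2, by norm_num [Nat.prime_two]⟩ ⟨1, by norm_num⟩
    (fun δ hδ => (hasSum_prime_mul_exp_log hδ).summable)
    (fun δ hδ => (hasSum_one_div_mul_exp hδ).summable) hstep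
  have key2 := ((tendsto_log_zeta_add_log.sub tendsto_tsum_logRemainder).add
    tendsto_log_one_sub_exp_sub_log).congr' (f₂ := fun δ : ℝ => ∑' n : ℕ,
      (if n.Prime then (1 / n : ℝ) else 0) * Real.exp (-(δ * Real.log n)) -
        ∑' n : ℕ, (1 / n : ℝ) * Real.exp (-(δ * n))) (by
    filter_upwards [self_mem_nhdsWithin] with δ hδ
    have hδ' : (0 : ℝ) < δ := hδ
    rw [(hasSum_prime_mul_exp_log hδ').tsum_eq, (hasSum_one_div_mul_exp hδ').tsum_eq]
    have h3 := (summable_primes_rpow hδ').tsum_add (summable_logRemainder hδ'.le)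
    simp only [logRemainder, add_sub_cancel] at h3 ⊢
    rw [h3]
    ring)
  have huniq := tendsto_nhds_unique key key2
  convert hM using 2
  linarith

/-- Mertens' third theorem. -/
theorem tendsto_log_mul_prod_primesLE_one_sub_inv :
    Tendsto (fun x : ℝ => Real.log x * ∏ p ∈ Nat.primesLE ⌊x⌋₊, (1 - (p : ℝ)⁻¹)) atTop
      (nhds (Real.exp (-Real.eulerMascheroniConstant))) := by
  have hs : Summable fun p : Nat.Primes => logRemainder (p : ℝ)⁻¹ := by
    simpa [Real.rpow_neg_one] using summable_logRemainder le_rfl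
  have h1 := ((Nat.Primes.hasSum_iff_hasSum_ite (f := fun n : ℕ => logRemainder (n : ℝ)⁻¹)).1
    hs.hasSum).tendsto_sum_nat.comp (tendsto_add_atTop_nat 1)
  have h2 := tendsto_sum_primesLE_inv_sub_log_log.add h1
  rw [sub_add_cancel] at h2
  have h3 : Tendsto (fun n : ℕ => ∑ p ∈ Nat.primesLE n, (-Real.log (1 - (p : ℝ)⁻¹)) -
      Real.log (Real.log n)) atTop (nhds Real.eulerMascheroniConstant) := by
    refine h2.congr fun n => ?_
    rw [Function.comp_apply, ← sum_filter, ← Nat.primesLE_eq_filter_range, sub_add_eq_add_sub,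
      ← sum_add_distrib]
    simp [logRemainder]
  have h4 := (Real.continuous_exp.tendsto _).comp
    (tendsto_sum_primesLE_floor_sub_log_log (f := fun p => -Real.log (1 - (p : ℝ)⁻¹)) h3).neg
  refine h4.congr' ?_
  filter_upwards [eventually_gt_atTop 1] with x hx
  rw [Function.comp_apply, neg_sub, sub_eq_add_neg, Real.exp_add, Real.exp_log (Real.log_pos hx),
    ← sum_neg_distrib, Real.exp_sum]
  congr 1
  refine prod_congr rfl fun p hp => ?_
  have hp2 : (1 : ℝ) < p := by exact_mod_cast (Nat.prime_of_mem_primesLE hp).one_lt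
  rw [neg_neg, Real.exp_log (sub_pos.2 (inv_lt_one_of_one_lt₀ hp2))]

lemma multipliable_twinPrime :
    Multipliable (fun p : Nat.Primes =>
      if 2 < (p : ℕ) then 1 - 1 / ((p : ℝ) - 1) ^ 2 else 1) := by
  have h : Summable fun p : Nat.Primes =>
      ‖if 2 < (p : ℕ) then -(1 / ((p : ℝ) - 1) ^ 2) else 0‖ := by
    refine Summable.of_nonneg_of_le (fun _ => norm_nonneg _) (fun p => ?_)
      (summable_primes_inv_sq.mul_left 2)
    have hp : (2 : ℝ) ≤ p := by exact_mod_cast p.2.two_le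
    split_ifs
    · rw [norm_neg, Real.norm_of_nonneg (by positivity)]
      have h1 : 0 < (p : ℝ) - 1 := by linarith
      rw [inv_pow, ← mul_assoc, ← div_eq_mul_inv, div_le_div_iff₀ (by positivity) (by positivity)]
      nlinarith
    · rw [norm_zero]
      positivity
  refine (multipliable_one_add_of_summable h).congr fun p => ?_
  split_ifs <;> ring

lemma filter_range_floor_eq (y : ℝ) :
    (Finset.range (Nat.floor y + 1)).filter (fun p : ℕ => p.Prime ∧ 2 < p ∧ (p : ℝ) ≤ y) =
      (Nat.primesLE ⌊y⌋₊).filter fun p => 2 < p := by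
  ext p
  simp only [mem_filter, Nat.mem_primesLE, mem_range, Nat.lt_succ_iff]
  constructor
  · rintro ⟨h1, h2, h3, -⟩
    exact ⟨⟨h1, h2⟩, h3⟩
  · rintro ⟨⟨h1, h2⟩, h3⟩
    exact ⟨h1, h2, h3, (Nat.le_floor_iff' h2.ne_zero).1 h1⟩

lemma tendsto_prod_twinPrimeConst :
    Tendsto (fun y : ℝ => ∏ p ∈ (Nat.primesLE ⌊y⌋₊).filter fun p => 2 < p,
      (p : ℝ) * ((p : ℝ) - 2) / ((p : ℝ) - 1) ^ 2) atTop (nhds twinPrimeConst) := by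
  have h := ((Nat.Primes.hasProd_iff_hasProd_ite (f := fun n : ℕ =>
    if 2 < n then 1 - 1 / ((n : ℝ) - 1) ^ 2 else 1)).1
    multipliable_twinPrime.hasProd).tendsto_prod_nat.comp
      ((tendsto_add_atTop_nat 1).comp (tendsto_nat_floor_atTop (α := ℝ)))
  refine h.congr fun y => ?_
  simp only [Function.comp_apply]
  rw [← prod_filter, ← Nat.primesLE_eq_filter_range, ← prod_filter]
  refine prod_congr rfl fun p hp => ?_
  have hp2 : (2 : ℝ) < p := by exact_mod_cast (mem_filter.1 hp).2
  have h1 : (p : ℝ) - 1 ≠ 0 := by linarith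
  field_simp
  ring

lemma prod_filter_two_lt_eq {n : ℕ} (hn : 2 ≤ n) :
    ∏ p ∈ (Nat.primesLE n).filter (fun p => 2 < p), ((p : ℝ) - 2) / p =
      4 * (∏ p ∈ Nat.primesLE n, (1 - (p : ℝ)⁻¹)) ^ 2 *
        ∏ p ∈ (Nat.primesLE n).filter (fun p => 2 < p),
          (p : ℝ) * ((p : ℝ) - 2) / ((p : ℝ) - 1) ^ 2 := by
  have hins : Nat.primesLE n = insert 2 ((Nat.primesLE n).filter fun p => 2 < p) := by
    ext p
    simp only [mem_insert, mem_filter, Nat.mem_primesLE]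
    constructor
    · rintro ⟨h1, h2⟩
      rcases h2.two_le.eq_or_lt with h | h
      exacts [Or.inl h.symm, Or.inr ⟨⟨h1, h2⟩, h⟩]
    · rintro (rfl | h)
      exacts [⟨hn, Nat.prime_two⟩, h.1]
  have h1 : ∏ p ∈ Nat.primesLE n, (1 - (p : ℝ)⁻¹) =
      1 / 2 * ∏ p ∈ (Nat.primesLE n).filter (fun p => 2 < p), (1 - (p : ℝ)⁻¹) := by
    conv_lhs => rw [hins]
    rw [prod_insert (by simp)]
    norm_num
  rw [h1, mul_pow, ← mul_assoc, show (4 : ℝ) * (1 / 2) ^ 2 = 1 by norm_num, one_mul, ← prod_pow,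
    ← prod_mul_distrib]
  refine prod_congr rfl fun p hp => ?_
  have hp2 : (2 : ℝ) < p := by exact_mod_cast (mem_filter.1 hp).2
  have h2 : (p : ℝ) - 1 ≠ 0 := by linarith
  have h3 : (p : ℝ) ≠ 0 := by linarith
  field_simp

/-- The infinite product defining `Π₂` converges; the finite products
`∏_{2 < p ≤ y} p(p−2)/(p−1)²` tend to `Π₂`; and
`(log y)² · ∏_{2 < p ≤ y} (p−2)/p → 4 e^{−2γ} Π₂` as `y → ∞`. -/
theorem statement17 :
    Multipliable (fun p : Nat.Primes =>
        if 2 < (p : ℕ) then 1 - 1 / ((p : ℝ) - 1) ^ 2 else 1) ∧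
    Tendsto (fun y : ℝ =>
        ∏ p ∈ (Finset.range (Nat.floor y + 1)).filter
            (fun p : ℕ => p.Prime ∧ 2 < p ∧ (p : ℝ) ≤ y),
          (p : ℝ) * ((p : ℝ) - 2) / ((p : ℝ) - 1) ^ 2)
      atTop (nhds twinPrimeConst) ∧
    Tendsto (fun y : ℝ =>
        (Real.log y) ^ 2 *
          ∏ p ∈ (Finset.range (Nat.floor y + 1)).filter
              (fun p : ℕ => p.Prime ∧ 2 < p ∧ (p : ℝ) ≤ y),
            ((p : ℝ) - 2) / p)
      atTop
      (nhds (4 * Real.exp (-2 * Real.eulerMascheroniConstant) * twinPrimeConst)) := by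
  simp only [filter_range_floor_eq]
  refine ⟨multipliable_twinPrime, tendsto_prod_twinPrimeConst, ?_⟩
  have h := ((tendsto_log_mul_prod_primesLE_one_sub_inv.pow 2).const_mul 4).mul
    tendsto_prod_twinPrimeConst
  rw [← Real.exp_nat_mul, show ((2 : ℕ) : ℝ) * -Real.eulerMascheroniConstant =
    -2 * Real.eulerMascheroniConstant by push_cast; ring] at h
  refine h.congr' ?_
  filter_upwards [eventually_ge_atTop 2] with y hy
  rw [prod_filter_two_lt_eq (Nat.le_floor (by exact_mod_cast hy))]
  ring
end
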